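/- arXiv:math/0212143 — 6 statements merged into one kernel-verified Lean document; each statement's English description precedes it below -/
import Mathlib

section
/- Let K(z,t) = K̃(|z|,t) with K̃ bounded and locally Hölder continuous on (0,∞)×ℝ. Let u be nonnegative, cylindrically symmetric, u ∈ L^{Q*}(ℝ^{2n+1}), with weak horizontal gradient G ∈ L²(ℝ^{2n+1};ℝ^{2n}), and suppose that ∫_{ℝ^{2n+1}} G · ∇_{ℍⁿ}φ = ∫_{ℝ^{2n+1}} K u^{Q*−1} φ holds for every cylindrically symmetric φ ∈ C_c^∞(ℝ^{2n+1}). Then the same identity ∫ G · ∇_{ℍⁿ}φ = ∫ K u^{Q*−1} φ holds for every φ ∈ C_c^∞(ℝ^{2n+1}), i.e. u is a weak solution of −Δ_{ℍⁿ}u = K u^{Q*−1} against all test functions, not only cylindrically symmetric ones. -/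
open MeasureTheory Filter Topology

noncomputable section

/-- Points of the Heisenberg group `ℍⁿ ≅ ℝⁿ × ℝⁿ × ℝ`, written `(x, y, t)`. -/
abbrev Pt (n : ℕ) : Type := (Fin n → ℝ) × (Fin n → ℝ) × ℝ

namespace Heis

/-- Unit vector in the `x_j` direction. -/
def ex (n : ℕ) (j : Fin n) : Pt n := (Pi.single j 1, 0, 0)

/-- Unit vector in the `y_j` direction. -/
def ey (n : ℕ) (j : Fin n) : Pt n := (0, Pi.single j 1, 0)

/-- Unit vector in the `t` direction. -/
def et (n : ℕ) : Pt n := (0, 0, 1)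

/-- The left-invariant vector field `X_j u = ∂u/∂x_j + 2 y_j ∂u/∂t`. -/
def Xd (n : ℕ) (j : Fin n) (u : Pt n → ℝ) (p : Pt n) : ℝ :=
  fderiv ℝ u p (ex n j) + 2 * p.2.1 j * fderiv ℝ u p (et n)

/-- The left-invariant vector field `Y_j u = ∂u/∂y_j - 2 x_j ∂u/∂t`. -/
def Yd (n : ℕ) (j : Fin n) (u : Pt n → ℝ) (p : Pt n) : ℝ :=
  fderiv ℝ u p (ey n j) - 2 * p.1 j * fderiv ℝ u p (et n)

/-- The Kohn Laplacian `Δ_{ℍⁿ} u = Σ_j (X_j² u + Y_j² u)`. -/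
def kohn (n : ℕ) (u : Pt n → ℝ) (p : Pt n) : ℝ :=
  ∑ j, (Xd n j (Xd n j u) p + Yd n j (Yd n j u) p)

/-- `|z|` for `p = (x, y, t)`, i.e. the Euclidean norm of `(x, y)`. -/
def znorm (n : ℕ) (p : Pt n) : ℝ :=
  Real.sqrt (∑ j, (p.1 j) ^ 2 + ∑ j, (p.2.1 j) ^ 2)

/-- Cylindrical symmetry: `u (z, t)` depends only on `(|z|, t)`. -/
def IsCyl (n : ℕ) (u : Pt n → ℝ) : Prop :=
  ∃ v : ℝ → ℝ → ℝ, ∀ p : Pt n, u p = v (znorm n p) p.2.2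

/-- Homogeneous dimension `Q = 2n + 2`. -/
def Qh (n : ℕ) : ℝ := 2 * n + 2

/-- Critical exponent `Q* = 2Q/(Q-2)`. -/
def Qs (n : ℕ) : ℝ := 2 * Qh n / (Qh n - 2)

/-- Smooth compactly supported test functions. -/
def TestFun (n : ℕ) (φ : Pt n → ℝ) : Prop :=
  ContDiff ℝ (⊤ : ℕ∞) φ ∧ HasCompactSupport φ

/-- Pointwise inner product of horizontal gradients `∇_{ℍⁿ}u · ∇_{ℍⁿ}v`. -/
def hDot (n : ℕ) (u v : Pt n → ℝ) (p : Pt n) : ℝ :=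
  ∑ j, (Xd n j u p * Xd n j v p + Yd n j u p * Yd n j v p)

/-- `|∇_{ℍⁿ}u|²`. -/
def hGradSq (n : ℕ) (u : Pt n → ℝ) (p : Pt n) : ℝ := hDot n u u p

/-- `G = (Gx, Gy)` is the weak horizontal gradient of `u`, and is in `L²`. -/
def HasWeakHGrad (n : ℕ) (u : Pt n → ℝ)
    (G : Pt n → (Fin n → ℝ) × (Fin n → ℝ)) : Prop :=
  (∀ j : Fin n, MemLp (fun p => (G p).1 j) 2 volume ∧
      MemLp (fun p => (G p).2 j) 2 volume) ∧
  ∀ φ : Pt n → ℝ, TestFun n φ → ∀ j : Fin n,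
    (∫ p : Pt n, u p * Xd n j φ p = -∫ p : Pt n, (G p).1 j * φ p) ∧
    (∫ p : Pt n, u p * Yd n j φ p = -∫ p : Pt n, (G p).2 j * φ p)

/-- `G · ∇_{ℍⁿ}φ` pointwise. -/
def gDot (n : ℕ) (G : Pt n → (Fin n → ℝ) × (Fin n → ℝ)) (φ : Pt n → ℝ)
    (p : Pt n) : ℝ :=
  ∑ j, ((G p).1 j * Xd n j φ p + (G p).2 j * Yd n j φ p)

/-- `u` is a positive cylindrically symmetric finite-energy weak solution of
`-Δ_{ℍⁿ} u = K u^{Q*-1}`. -/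
def IsWeakSol (n : ℕ) (K u : Pt n → ℝ) : Prop :=
  IsCyl n u ∧ MemLp u (ENNReal.ofReal (Qs n)) volume ∧
  (∀ᵐ p : Pt n, 0 < u p) ∧
  ∃ G : Pt n → (Fin n → ℝ) × (Fin n → ℝ), HasWeakHGrad n u G ∧
    ∀ φ : Pt n → ℝ, TestFun n φ →
      ∫ p : Pt n, gDot n G φ p = ∫ p : Pt n, K p * u p ^ (Qs n - 1) * φ p

/-- The standard bubble `U_{μ,s}`. -/
def bubble (n : ℕ) (μ s : ℝ) (p : Pt n) : ℝ :=
  μ ^ (-(Qh n - 2) / 2) *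
    (((p.2.2 - s) / μ ^ 2) ^ 2 + (1 + (znorm n p) ^ 2 / μ ^ 2) ^ 2)
      ^ (-(Qh n - 2) / 4)

/-- Local Hölder continuity of an uncurried function of two real variables on a set. -/
def LocHolderOn (f : ℝ → ℝ → ℝ) (s : Set (ℝ × ℝ)) : Prop :=
  ∀ x ∈ s, ∃ t ∈ nhdsWithin x s, ∃ C α : NNReal, 0 < α ∧
    HolderOnWith C α (fun q : ℝ × ℝ => f q.1 q.2) t

/-- `K` is cylindrically symmetric, `K(z,t) = K̃(|z|,t)`, with `K̃` locally Hölder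
continuous on `(0,∞) × ℝ`. -/
def CylHolder (n : ℕ) (K : Pt n → ℝ) : Prop :=
  ∃ Kt : ℝ → ℝ → ℝ, (∀ p : Pt n, K p = Kt (znorm n p) p.2.2) ∧
    LocHolderOn Kt (Set.Ioi 0 ×ˢ Set.univ)

/-- The standard solution `ω(z,t) = (Q-2)^{(Q-2)/2} (t² + (1+|z|²)²)^{-(Q-2)/4}`. -/
def omegaFun (n : ℕ) (p : Pt n) : ℝ :=
  (Qh n - 2) ^ ((Qh n - 2) / 2) *
    (p.2.2 ^ 2 + (1 + (znorm n p) ^ 2) ^ 2) ^ (-(Qh n - 2) / 4)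

end Heis
namespace Heis

/-- The Cayley transform `F : S^{2n+1} ∖ {(0,…,0,-1)} → ℍⁿ`. -/
def cayley (n : ℕ) (ζ : Fin (n + 1) → ℂ) : Pt n :=
  (fun j => (ζ j.castSucc / (1 + ζ (Fin.last n))).re,
   fun j => (ζ j.castSucc / (1 + ζ (Fin.last n))).im,
   (Complex.I * (1 - ζ (Fin.last n)) / (1 + ζ (Fin.last n))).re)

/-- The partial Laplacian `Δ_{x,y} k = Σ_i (∂²k/∂x_i² + ∂²k/∂y_i²)`. -/
def lapXY (n : ℕ) (k : Pt n → ℝ) (p : Pt n) : ℝ :=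
  ∑ j, (fderiv ℝ (fun q => fderiv ℝ k q (ex n j)) p (ex n j)
      + fderiv ℝ (fun q => fderiv ℝ k q (ey n j)) p (ey n j))

/-- The rescaling operator `(𝒰_{μ,s} u)(z,t) = μ^{-(Q-2)/2} u(z/μ, (t-s)/μ²)`. -/
def rescale (n : ℕ) (μ s : ℝ) (u : Pt n → ℝ) (p : Pt n) : ℝ :=
  μ ^ (-(Qh n - 2) / 2) *
    u (fun j => p.1 j / μ, fun j => p.2.1 j / μ, (p.2.2 - s) / μ ^ 2)

/-- The point `(μ z, μ² t + s)`. -/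
def scalePt (n : ℕ) (μ s : ℝ) (p : Pt n) : Pt n :=
  (fun j => μ * p.1 j, fun j => μ * p.2.1 j, μ ^ 2 * p.2.2 + s)

/-- The reduced functional `Γ(μ,s) = (1/Q*) ∫ k(μz, μ²t+s) ω^{Q*}`. -/
def Gam (n : ℕ) (k : Pt n → ℝ) (μ s : ℝ) : ℝ :=
  (1 / Qs n) * ∫ p : Pt n, k (scalePt n μ s p) * omegaFun n p ^ Qs n

/-- The Heisenberg group law
`(x,y,t) ∘ (x',y',t') = (x+x', y+y', t+t'+2x'·y-2x·y')`. -/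
def heisMul (n : ℕ) (a b : Pt n) : Pt n :=
  (fun j => a.1 j + b.1 j, fun j => a.2.1 j + b.2.1 j,
   a.2.2 + b.2.2 + 2 * (∑ j, b.1 j * a.2.1 j) - 2 * (∑ j, a.1 j * b.2.1 j))

end Heis

open Heis

namespace HeisAux

open Heis

/-- complex coordinates -/
def zc {n : ℕ} (p : Pt n) : Fin n → ℂ := fun j => ⟨p.1 j, p.2.1 j⟩

/-- action of complex matrices -/
def act {n : ℕ} (A : Matrix (Fin n) (Fin n) ℂ) (p : Pt n) : Pt n :=
  (fun j => (A.mulVec (zc p) j).re, fun j => (A.mulVec (zc p) j).im, p.2.2)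

lemma zc_act {n : ℕ} (A : Matrix (Fin n) (Fin n) ℂ) (p : Pt n) :
    zc (act A p) = A.mulVec (zc p) := by
  funext j; rfl

lemma act_act {n : ℕ} (A B : Matrix (Fin n) (Fin n) ℂ) (p : Pt n) :
    act A (act B p) = act (A * B) p := by
  simp only [act]
  rw [show zc ((fun j => (B.mulVec (zc p) j).re, fun j => (B.mulVec (zc p) j).im, p.2.2) : Pt n)
    = B.mulVec (zc p) from rfl, Matrix.mulVec_mulVec]

lemma act_one {n : ℕ} (p : Pt n) : act (1 : Matrix (Fin n) (Fin n) ℂ) p = p := by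
  simp [act, zc]

lemma zc_add {n : ℕ} (p q : Pt n) : zc (p + q) = zc p + zc q := by
  funext j; rfl

lemma zc_smul {n : ℕ} (c : ℝ) (p : Pt n) : zc (c • p) = (c : ℂ) • zc p := by
  funext j; apply Complex.ext <;> simp [zc]

/-- the action as a linear map -/
def actL {n : ℕ} (A : Matrix (Fin n) (Fin n) ℂ) : Pt n →ₗ[ℝ] Pt n where
  toFun := act A
  map_add' p q := by
    simp only [act, zc_add, Matrix.mulVec_add]
    rfl
  map_smul' c p := by
    simp only [act, zc_smul, Matrix.mulVec_smul]
    refine Prod.ext ?_ (Prod.ext ?_ ?_)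
    · funext j; simp
    · funext j; simp
    · simp

def actC {n : ℕ} (A : Matrix (Fin n) (Fin n) ℂ) : Pt n →L[ℝ] Pt n :=
  LinearMap.toContinuousLinearMap (actL A)

@[simp] lemma actC_apply {n : ℕ} (A : Matrix (Fin n) (Fin n) ℂ) (p : Pt n) :
    actC A p = act A p := rfl

lemma znorm_eq {n : ℕ} (p : Pt n) :
    znorm n p = Real.sqrt (dotProduct (star (zc p)) (zc p)).re := by
  unfold znorm
  congr 1
  simp only [dotProduct, Complex.re_sum, ← Finset.sum_add_distrib]
  refine Finset.sum_congr rfl fun j _ => ?_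
  simp [zc]; ring

lemma znorm_act {n : ℕ} (U : Matrix.unitaryGroup (Fin n) ℂ) (p : Pt n) :
    znorm n (act U.1 p) = znorm n p := by
  rw [znorm_eq, znorm_eq, zc_act, Matrix.star_mulVec, Matrix.dotProduct_mulVec,
    Matrix.vecMul_vecMul]
  have : (U.1).conjTranspose * U.1 = 1 := Matrix.UnitaryGroup.star_mul_self U
  rw [this, Matrix.vecMul_one]

lemma cyl_act {n : ℕ} {u : Pt n → ℝ} (hu : IsCyl n u) (U : Matrix.unitaryGroup (Fin n) ℂ)
    (p : Pt n) : u (act U.1 p) = u p := by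
  obtain ⟨v, hv⟩ := hu
  rw [hv, hv, znorm_act]; rfl

lemma act_ex {n : ℕ} (A : Matrix (Fin n) (Fin n) ℂ) (j : Fin n) :
    act A (ex n j) = ∑ k, ((A k j).re • ex n k + (A k j).im • ey n k) := by
  have h : zc (ex n j) = Pi.single j 1 := by
    funext k; by_cases hk : k = j
    · subst hk; simp [zc, ex, Complex.ext_iff]
    · simp [zc, ex, hk, Complex.ext_iff]
  simp only [act, h, Matrix.mulVec_single_one]
  refine Prod.ext ?_ (Prod.ext ?_ ?_)
  · funext i
    simp [Prod.fst_sum, ex, ey, Finset.sum_apply, Pi.single_apply]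
  · funext i
    simp [Prod.fst_sum, Prod.snd_sum, ex, ey, Finset.sum_apply, Pi.single_apply]
  · simp [Prod.snd_sum, ex, ey]

lemma act_ey {n : ℕ} (A : Matrix (Fin n) (Fin n) ℂ) (j : Fin n) :
    act A (ey n j) = ∑ k, (-(A k j).im • ex n k + (A k j).re • ey n k) := by
  have h : zc (ey n j) = Pi.single j Complex.I := by
    funext k; by_cases hk : k = j
    · subst hk; simp [zc, ey, Complex.ext_iff]
    · simp [zc, ey, hk, Complex.ext_iff]
  simp only [act, h, Matrix.mulVec_single]
  refine Prod.ext ?_ (Prod.ext ?_ ?_)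
  · funext i
    simp [Prod.fst_sum, ex, ey, Finset.sum_apply, Pi.single_apply]
  · funext i
    simp [Prod.fst_sum, Prod.snd_sum, ex, ey, Finset.sum_apply, Pi.single_apply]
  · simp [Prod.snd_sum, ex, ey]

lemma act_et {n : ℕ} (A : Matrix (Fin n) (Fin n) ℂ) : act A (et n) = et n := by
  have h : zc (et n) = 0 := by
    funext k; simp [zc, et, Complex.ext_iff]
  simp only [act, h, Matrix.mulVec_zero]
  rfl

lemma unit_sum {n : ℕ} (U : Matrix.unitaryGroup (Fin n) ℂ) (p : Pt n) (j : Fin n) :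
    ∑ k, star (U.1 k j) * zc (act U.1 p) k = zc p j := by
  have : (U.1).conjTranspose * U.1 = 1 := Matrix.UnitaryGroup.star_mul_self U
  have h2 : (U.1).conjTranspose.mulVec (zc (act U.1 p)) = zc p := by
    rw [zc_act, Matrix.mulVec_mulVec, this, Matrix.one_mulVec]
  exact congrFun h2 j

lemma unit_rows {n : ℕ} (U : Matrix.unitaryGroup (Fin n) ℂ) (k l : Fin n) :
    ∑ j, U.1 k j * star (U.1 l j) = if k = l then 1 else 0 := by
  have : U.1 * (U.1).conjTranspose = 1 := Unitary.mul_star_self_of_mem U.2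
  have h2 := congrFun (congrFun this k) l
  simpa [Matrix.mul_apply, Matrix.one_apply] using h2

lemma Xd_act {n : ℕ} (U : Matrix.unitaryGroup (Fin n) ℂ) (j : Fin n) (f : Pt n → ℝ)
    (hf : Differentiable ℝ f) (p : Pt n) :
    Xd n j (fun q => f (act U.1 q)) p =
      ∑ k, ((U.1 k j).re * Xd n k f (act U.1 p) + (U.1 k j).im * Yd n k f (act U.1 p)) := by
  have hd : fderiv ℝ (fun q => f (act U.1 q)) p = (fderiv ℝ f (act U.1 p)).comp (actC U.1) :=
    ((hf (act U.1 p)).hasFDerivAt.comp p ((actC U.1).hasFDerivAt (x := p))).fderiv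
  have h := congrArg Complex.im (unit_sum U p j)
  simp only [Complex.im_sum] at h
  simp only [Xd, Yd, hd, ContinuousLinearMap.comp_apply, actC_apply, act_ex, act_et, map_sum,
    map_add, map_smul, smul_eq_mul]
  have e : p.2.1 j = (zc p j).im := rfl
  rw [e, ← h, Finset.mul_sum, Finset.sum_mul, ← Finset.sum_add_distrib]
  refine Finset.sum_congr rfl fun k _ => ?_
  simp [zc]
  ring

lemma Yd_act {n : ℕ} (U : Matrix.unitaryGroup (Fin n) ℂ) (j : Fin n) (f : Pt n → ℝ)
    (hf : Differentiable ℝ f) (p : Pt n) :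
    Yd n j (fun q => f (act U.1 q)) p =
      ∑ k, (-(U.1 k j).im * Xd n k f (act U.1 p) + (U.1 k j).re * Yd n k f (act U.1 p)) := by
  have hd : fderiv ℝ (fun q => f (act U.1 q)) p = (fderiv ℝ f (act U.1 p)).comp (actC U.1) :=
    ((hf (act U.1 p)).hasFDerivAt.comp p ((actC U.1).hasFDerivAt (x := p))).fderiv
  have h := congrArg Complex.re (unit_sum U p j)
  simp only [Complex.re_sum] at h
  simp only [Xd, Yd, hd, ContinuousLinearMap.comp_apply, actC_apply, act_ey, act_et, map_sum,
    map_add, map_smul, smul_eq_mul]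
  have e : p.1 j = (zc p j).re := rfl
  rw [e, ← h, Finset.mul_sum, Finset.sum_mul, ← Finset.sum_sub_distrib]
  refine Finset.sum_congr rfl fun k _ => ?_
  simp [zc]
  ring

lemma fderiv_lin {n : ℕ} (a b : Fin n → ℝ) (f g : Fin n → Pt n → ℝ)
    (hf : ∀ k, Differentiable ℝ (f k)) (hg : ∀ k, Differentiable ℝ (g k)) (p v : Pt n) :
    fderiv ℝ (fun q => ∑ k, (a k * f k q + b k * g k q)) p v =
      ∑ k, (a k * fderiv ℝ (f k) p v + b k * fderiv ℝ (g k) p v) := by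
  have : HasFDerivAt (fun q => ∑ k, (a k * f k q + b k * g k q))
      (∑ k, (a k • fderiv ℝ (f k) p + b k • fderiv ℝ (g k) p)) p := by
    apply HasFDerivAt.fun_sum
    intro k _
    exact ((hf k p).hasFDerivAt.const_mul (a k)).add ((hg k p).hasFDerivAt.const_mul (b k))
  rw [this.fderiv]
  simp

lemma Xd_lin {n : ℕ} (a b : Fin n → ℝ) (f g : Fin n → Pt n → ℝ)
    (hf : ∀ k, Differentiable ℝ (f k)) (hg : ∀ k, Differentiable ℝ (g k)) (p : Pt n) (j : Fin n) :
    Xd n j (fun q => ∑ k, (a k * f k q + b k * g k q)) p =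
      ∑ k, (a k * Xd n j (f k) p + b k * Xd n j (g k) p) := by
  simp only [Xd, fderiv_lin a b f g hf hg, Finset.mul_sum, ← Finset.sum_add_distrib]
  refine Finset.sum_congr rfl fun k _ => ?_
  ring

lemma Yd_lin {n : ℕ} (a b : Fin n → ℝ) (f g : Fin n → Pt n → ℝ)
    (hf : ∀ k, Differentiable ℝ (f k)) (hg : ∀ k, Differentiable ℝ (g k)) (p : Pt n) (j : Fin n) :
    Yd n j (fun q => ∑ k, (a k * f k q + b k * g k q)) p =
      ∑ k, (a k * Yd n j (f k) p + b k * Yd n j (g k) p) := by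
  simp only [Yd, fderiv_lin a b f g hf hg, Finset.mul_sum, ← Finset.sum_sub_distrib]
  refine Finset.sum_congr rfl fun k _ => ?_
  ring

lemma tf_diff {n : ℕ} {φ : Pt n → ℝ} (h : TestFun n φ) : Differentiable ℝ φ :=
  h.1.differentiable (by simp)

lemma contDiff_fderiv_apply {n : ℕ} {φ : Pt n → ℝ} (h : TestFun n φ) (v : Pt n) :
    ContDiff ℝ (⊤ : ℕ∞) (fun p => fderiv ℝ φ p v) :=
  (h.1.fderiv_right (m := (⊤ : ℕ∞)) (by simp)).clm_apply contDiff_const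

lemma testFun_Xd {n : ℕ} {φ : Pt n → ℝ} (h : TestFun n φ) (j : Fin n) : TestFun n (Xd n j φ) := by
  constructor
  · have h1 := contDiff_fderiv_apply h (ex n j)
    have h2 := contDiff_fderiv_apply h (et n)
    unfold Xd
    fun_prop
  · refine h.2.fderiv (𝕜 := ℝ) |>.mono ?_
    intro p hp hp0
    simp [Xd, hp0] at hp

lemma testFun_Yd {n : ℕ} {φ : Pt n → ℝ} (h : TestFun n φ) (j : Fin n) : TestFun n (Yd n j φ) := by
  constructor
  · have h1 := contDiff_fderiv_apply h (ey n j)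
    have h2 := contDiff_fderiv_apply h (et n)
    unfold Yd
    fun_prop
  · refine h.2.fderiv (𝕜 := ℝ) |>.mono ?_
    intro p hp hp0
    simp [Yd, hp0] at hp

lemma act_inv_act {n : ℕ} (U : Matrix.unitaryGroup (Fin n) ℂ) (p : Pt n) :
    act (U⁻¹).1 (act U.1 p) = p := by
  rw [act_act]
  have : (U⁻¹).1 * U.1 = 1 := congrArg Subtype.val (inv_mul_cancel U)
  rw [this, act_one]

lemma act_act_inv {n : ℕ} (U : Matrix.unitaryGroup (Fin n) ℂ) (p : Pt n) :
    act U.1 (act (U⁻¹).1 p) = p := by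
  simpa using act_inv_act U⁻¹ p

def actH {n : ℕ} (U : Matrix.unitaryGroup (Fin n) ℂ) : Pt n ≃ₜ Pt n where
  toFun := act U.1
  invFun := act (U⁻¹).1
  left_inv := act_inv_act U
  right_inv := act_act_inv U
  continuous_toFun := (actC U.1).continuous
  continuous_invFun := (actC (U⁻¹).1).continuous

lemma testFun_act {n : ℕ} {φ : Pt n → ℝ} (h : TestFun n φ) (U : Matrix.unitaryGroup (Fin n) ℂ) :
    TestFun n (fun q => φ (act U.1 q)) :=
  ⟨h.1.comp (actC U.1).contDiff, h.2.comp_homeomorph (actH U)⟩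

lemma kohn_alg {n : ℕ} (U : Matrix.unitaryGroup (Fin n) ℂ) (XX YX XY YY : Fin n → Fin n → ℝ) :
    ∑ j, (∑ k, ((U.1 k j).re * ∑ l, ((U.1 l j).re * XX l k + (U.1 l j).im * YX l k) +
        (U.1 k j).im * ∑ l, ((U.1 l j).re * XY l k + (U.1 l j).im * YY l k)) +
      ∑ k, (-(U.1 k j).im * ∑ l, (-(U.1 l j).im * XX l k + (U.1 l j).re * YX l k) +
        (U.1 k j).re * ∑ l, (-(U.1 l j).im * XY l k + (U.1 l j).re * YY l k)))
      = ∑ j, (XX j j + YY j j) := by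
  have hr : ∀ k l, ∑ j, ((U.1 k j).re * (U.1 l j).re + (U.1 k j).im * (U.1 l j).im) =
      if k = l then 1 else 0 := by
    intro k l
    have h := congrArg Complex.re (unit_rows U k l)
    rw [Complex.re_sum] at h
    rw [show (if k = l then (1:ℝ) else 0) = (if k = l then (1:ℂ) else 0).re by split_ifs <;> simp,
      ← h]
    refine Finset.sum_congr rfl fun j _ => ?_
    simp
  have hi : ∀ k l, ∑ j, ((U.1 k j).im * (U.1 l j).re - (U.1 k j).re * (U.1 l j).im) = 0 := by
    intro k l
    have h := congrArg Complex.im (unit_rows U k l)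
    rw [Complex.im_sum] at h
    rw [show (0:ℝ) = (if k = l then (1:ℂ) else 0).im by split_ifs <;> simp,
      ← h]
    refine Finset.sum_congr rfl fun j _ => ?_
    simp; ring
  have step : ∀ j, (∑ k, ((U.1 k j).re * ∑ l, ((U.1 l j).re * XX l k + (U.1 l j).im * YX l k) +
        (U.1 k j).im * ∑ l, ((U.1 l j).re * XY l k + (U.1 l j).im * YY l k)) +
      ∑ k, (-(U.1 k j).im * ∑ l, (-(U.1 l j).im * XX l k + (U.1 l j).re * YX l k) +
        (U.1 k j).re * ∑ l, (-(U.1 l j).im * XY l k + (U.1 l j).re * YY l k))) =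
      ∑ k, ∑ l, (((U.1 k j).re * (U.1 l j).re + (U.1 k j).im * (U.1 l j).im) * (XX l k + YY l k)
       + ((U.1 k j).im * (U.1 l j).re - (U.1 k j).re * (U.1 l j).im) * (XY l k - YX l k)) := by
    intro j
    simp only [Finset.mul_sum, ← Finset.sum_add_distrib]
    refine Finset.sum_congr rfl fun k _ => Finset.sum_congr rfl fun l _ => ?_
    ring
  simp only [step]
  rw [Finset.sum_comm]
  refine Finset.sum_congr rfl fun k _ => ?_
  rw [Finset.sum_comm]
  simp only [Finset.sum_add_distrib, ← Finset.sum_mul]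
  simp only [hi, ← Finset.sum_add_distrib]
  have : ∀ l, (∑ j, (U.1 k j).re * (U.1 l j).re + ∑ j, (U.1 k j).im * (U.1 l j).im) =
      if k = l then 1 else 0 := fun l => by rw [← hr k l, Finset.sum_add_distrib]
  simp [hr]

lemma kohn_act {n : ℕ} {φ : Pt n → ℝ} (h : TestFun n φ) (U : Matrix.unitaryGroup (Fin n) ℂ)
    (p : Pt n) : kohn n (fun q => φ (act U.1 q)) p = kohn n φ (act U.1 p) := by
  have dX : ∀ k, Differentiable ℝ (Xd n k φ) := fun k => tf_diff (testFun_Xd h k)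
  have dY : ∀ k, Differentiable ℝ (Yd n k φ) := fun k => tf_diff (testFun_Yd h k)
  have dX' : ∀ k, Differentiable ℝ (fun q => Xd n k φ (act U.1 q)) :=
    fun k => tf_diff (testFun_act (testFun_Xd h k) U)
  have dY' : ∀ k, Differentiable ℝ (fun q => Yd n k φ (act U.1 q)) :=
    fun k => tf_diff (testFun_act (testFun_Yd h k) U)
  have eX : ∀ j, Xd n j (fun q => φ (act U.1 q)) = fun p =>
      ∑ k, ((U.1 k j).re * Xd n k φ (act U.1 p) + (U.1 k j).im * Yd n k φ (act U.1 p)) :=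
    fun j => funext fun p => Xd_act U j φ (tf_diff h) p
  have eY : ∀ j, Yd n j (fun q => φ (act U.1 q)) = fun p =>
      ∑ k, (-(U.1 k j).im * Xd n k φ (act U.1 p) + (U.1 k j).re * Yd n k φ (act U.1 p)) :=
    fun j => funext fun p => Yd_act U j φ (tf_diff h) p
  unfold kohn
  rw [← kohn_alg U (fun l k => Xd n l (Xd n k φ) (act U.1 p)) (fun l k => Yd n l (Xd n k φ) (act U.1 p))
    (fun l k => Xd n l (Yd n k φ) (act U.1 p)) (fun l k => Yd n l (Yd n k φ) (act U.1 p))]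
  refine Finset.sum_congr rfl fun j _ => ?_
  rw [eX, eY]
  rw [Xd_lin _ _ (fun k q => Xd n k φ (act U.1 q)) (fun k q => Yd n k φ (act U.1 q)) dX' dY',
    Yd_lin _ _ (fun k q => Xd n k φ (act U.1 q)) (fun k q => Yd n k φ (act U.1 q)) dX' dY']
  simp only [fun k => Xd_act U j _ (dX k) p, fun k => Xd_act U j _ (dY k) p,
    fun k => Yd_act U j _ (dX k) p, fun k => Yd_act U j _ (dY k) p]

end HeisAux

namespace HeisAux

instance compactU (n : ℕ) : CompactSpace (Matrix.unitaryGroup (Fin n) ℂ) := by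
  refine (isCompact_iff_compactSpace (s := ((Matrix.unitaryGroup (Fin n) ℂ :
    Submonoid (Matrix (Fin n) (Fin n) ℂ)) : Set (Matrix (Fin n) (Fin n) ℂ)))).1 ?_
  have hcl : IsClosed ((Matrix.unitaryGroup (Fin n) ℂ : Submonoid (Matrix (Fin n) (Fin n) ℂ)) :
      Set (Matrix (Fin n) (Fin n) ℂ)) := by
    have : ((Matrix.unitaryGroup (Fin n) ℂ : Submonoid (Matrix (Fin n) (Fin n) ℂ)) :
      Set (Matrix (Fin n) (Fin n) ℂ)) = {A | A * A.conjTranspose = 1} := by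
      ext A; exact Matrix.mem_unitaryGroup_iff
    rw [this]
    exact isClosed_eq (by fun_prop) continuous_const
  have hK : IsCompact (Set.univ.pi fun _ : Fin n => Set.univ.pi fun _ : Fin n =>
      Metric.closedBall (0:ℂ) 1) :=
    isCompact_univ_pi fun _ => isCompact_univ_pi fun _ => isCompact_closedBall _ _
  refine IsCompact.of_isClosed_subset hK hcl ?_
  intro A hA i _ j _
  simpa using entry_norm_bound_of_unitary hA i j

lemma znorm_eq_norm {n : ℕ} (p : Pt n) : znorm n p = ‖WithLp.toLp 2 (zc p)‖ := by
  rw [EuclideanSpace.norm_eq]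
  unfold znorm
  congr 1
  rw [← Finset.sum_add_distrib]
  refine Finset.sum_congr rfl fun j _ => ?_
  simp [zc, Complex.sq_norm, Complex.normSq_apply]; ring

lemma exists_unitary {n : ℕ} (v w : EuclideanSpace ℂ (Fin n)) (h : ‖v‖ = ‖w‖) :
    ∃ U : Matrix.unitaryGroup (Fin n) ℂ, U.1.mulVec v = w := by
  classical
  obtain ⟨L, hL⟩ : ∃ L : EuclideanSpace ℂ (Fin n) →ₗᵢ[ℂ] EuclideanSpace ℂ (Fin n), L v = w := by
    by_cases hv : v = 0
    · refine ⟨LinearIsometry.id, ?_⟩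
      subst hv
      have : w = 0 := by rw [← norm_eq_zero, ← h, norm_zero]
      simp [this]
    · let e := LinearEquiv.toSpanNonzeroSingleton ℂ _ v hv
      let l : (Submodule.span ℂ {v}) →ₗ[ℂ] EuclideanSpace ℂ (Fin n) :=
        (LinearMap.toSpanSingleton ℂ _ w).comp e.symm.toLinearMap
      have hl : ∀ c : ℂ, l (e c) = c • w := fun c => by simp [l]
      let L0 : (Submodule.span ℂ {v}) →ₗᵢ[ℂ] EuclideanSpace ℂ (Fin n) :=
        ⟨l, fun x => by
          obtain ⟨c, rfl⟩ := e.surjective x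
          rw [hl, norm_smul, ← h, ← norm_smul]; rfl⟩
      refine ⟨L0.extend, ?_⟩
      have h1 := L0.extend_apply (e 1)
      have h2 : L0 (e 1) = w := by
        change l (e 1) = w
        rw [hl, one_smul]
      rw [h2] at h1
      rw [← h1]
      congr 1
      change v = (1:ℂ) • v
      rw [one_smul]
  let b := EuclideanSpace.basisFun (Fin n) ℂ
  let A : Matrix (Fin n) (Fin n) ℂ := LinearMap.toMatrix b.toBasis b.toBasis L.toLinearMap
  have hmv : A.mulVec v = w := by
    have := LinearMap.toMatrix_mulVec_repr b.toBasis b.toBasis L.toLinearMap v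
    have h3 : ∀ x : EuclideanSpace ℂ (Fin n), (b.toBasis.repr x : Fin n → ℂ) = x := fun x => by
      funext i; simp [b]
    rw [h3, h3] at this
    rw [this, ← hL]; rfl
  have hA : A ∈ Matrix.unitaryGroup (Fin n) ℂ := by
    rw [Matrix.mem_unitaryGroup_iff']
    ext i j
    rw [Matrix.mul_apply]
    have hin : inner ℂ (L (b i)) (L (b j)) = inner ℂ (b i) (b j) := L.inner_map_map _ _
    rw [orthonormal_iff_ite.mp b.orthonormal i j] at hin
    rw [Matrix.one_apply, ← hin, PiLp.inner_apply]
    refine Finset.sum_congr rfl fun k _ => ?_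
    simp [A, LinearMap.toMatrix_apply, b, mul_comm]
  exact ⟨⟨A, hA⟩, hmv⟩

lemma act_transitive {n : ℕ} (p q : Pt n) (h : znorm n p = znorm n q) (ht : p.2.2 = q.2.2) :
    ∃ U : Matrix.unitaryGroup (Fin n) ℂ, act U.1 p = q := by
  rw [znorm_eq_norm, znorm_eq_norm] at h
  obtain ⟨U, hU⟩ := exists_unitary _ _ h
  refine ⟨U, ?_⟩
  have hU' : U.1.mulVec (zc p) = zc q := hU
  simp only [act, hU', ht]
  rfl

lemma isCyl_of_inv {n : ℕ} {f : Pt n → ℝ}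
    (h : ∀ (U : Matrix.unitaryGroup (Fin n) ℂ) p, f (act U.1 p) = f p) : IsCyl n f := by
  classical
  refine ⟨fun r t => if h : ∃ q : Pt n, znorm n q = r ∧ q.2.2 = t then f h.choose else 0, ?_⟩
  intro p
  have hex : ∃ q : Pt n, znorm n q = znorm n p ∧ q.2.2 = p.2.2 := ⟨p, rfl, rfl⟩
  beta_reduce
  rw [dif_pos hex]
  obtain ⟨U, hU⟩ := act_transitive _ p hex.choose_spec.1 hex.choose_spec.2
  rw [← h U hex.choose, hU]

lemma continuous_znorm (n : ℕ) : Continuous (znorm n) := by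
  unfold znorm; fun_prop

instance haarPt (n : ℕ) : (volume : Measure (Pt n)).IsAddHaarMeasure := by
  have h : (volume : Measure ((Fin n → ℝ) × ℝ)).IsAddHaarMeasure :=
    Measure.prod.instIsAddHaarMeasure _ _
  exact Measure.prod.instIsAddHaarMeasure (volume : Measure (Fin n → ℝ))
    (volume : Measure ((Fin n → ℝ) × ℝ))

lemma act_mp {n : ℕ} (U : Matrix.unitaryGroup (Fin n) ℂ) :
    MeasurePreserving (act U.1 : Pt n → Pt n) volume volume := by
  let S : Set (Pt n) := {p | znorm n p < 1 ∧ |p.2.2| < 1}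
  have hSo : IsOpen S :=
    (isOpen_lt (continuous_znorm n) continuous_const).inter
      (isOpen_lt (f := fun p : Pt n => |p.2.2|) (by fun_prop) continuous_const)
  have hS0 : (volume : Measure (Pt n)) S ≠ 0 :=
    (hSo.measure_pos volume ⟨0, by simp [S, znorm]⟩).ne'
  have hSb : S ⊆ Metric.closedBall 0 1 := by
    rintro p ⟨hp, ht⟩
    rw [mem_closedBall_zero_iff]
    have hp2 : ∑ j, (p.1 j) ^ 2 + ∑ j, (p.2.1 j) ^ 2 ≤ 1 := by
      unfold znorm at hp
      rw [Real.sqrt_lt' one_pos] at hp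
      simpa using hp.le
    have n1 : 0 ≤ ∑ j, (p.1 j) ^ 2 := Finset.sum_nonneg fun j _ => sq_nonneg _
    have n2 : 0 ≤ ∑ j, (p.2.1 j) ^ 2 := Finset.sum_nonneg fun j _ => sq_nonneg _
    refine max_le ?_ (max_le ?_ ht.le)
    · rw [pi_norm_le_iff_of_nonneg zero_le_one]
      intro j
      have := Finset.single_le_sum (f := fun j => (p.1 j) ^ 2) (fun i _ => sq_nonneg _)
        (Finset.mem_univ j)
      rw [Real.norm_eq_abs, ← sq_le_one_iff_abs_le_one]
      linarith
    · rw [pi_norm_le_iff_of_nonneg zero_le_one]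
      intro j
      have := Finset.single_le_sum (f := fun j => (p.2.1 j) ^ 2) (fun i _ => sq_nonneg _)
        (Finset.mem_univ j)
      rw [Real.norm_eq_abs, ← sq_le_one_iff_abs_le_one]
      linarith
  have hSt : (volume : Measure (Pt n)) S ≠ ⊤ :=
    ((measure_mono hSb).trans_lt (isCompact_closedBall _ _).measure_lt_top).ne
  have himg : (actL U.1) '' S = S := by
    ext p
    constructor
    · rintro ⟨q, hq, rfl⟩
      exact ⟨(znorm_act U q).trans_lt hq.1, hq.2⟩
    · intro hp
      exact ⟨act (U⁻¹).1 p, ⟨(znorm_act U⁻¹ p).trans_lt hp.1, hp.2⟩, act_act_inv U p⟩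
  have hdet := Measure.addHaar_image_linearMap (volume : Measure (Pt n)) (actL U.1) S
  rw [himg] at hdet
  have hd1 : ENNReal.ofReal |LinearMap.det (actL U.1)| = 1 := by
    have := (ENNReal.mul_left_inj (a := ENNReal.ofReal |LinearMap.det (actL U.1)|) (b := 1)
      hS0 hSt).1 (by rw [← hdet, one_mul])
    exact this
  have hd2 : |LinearMap.det (actL U.1)| = 1 := by
    rwa [ENNReal.ofReal_eq_one] at hd1
  refine ⟨(actC U.1).continuous.measurable, ?_⟩
  have := Measure.map_linearMap_addHaar_eq_smul_addHaar (volume : Measure (Pt n))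
    (f := actL U.1) (by intro h0; rw [h0] at hd2; simp at hd2)
  rw [abs_inv, hd2, inv_one, ENNReal.ofReal_one, one_smul] at this
  exact this

lemma integral_act {n : ℕ} (U : Matrix.unitaryGroup (Fin n) ℂ) (f : Pt n → ℝ) :
    ∫ p, f (act U.1 p) = ∫ p, f p :=
  (act_mp U).integral_comp (actH U).measurableEmbedding f

lemma continuous_act {n : ℕ} :
    Continuous fun x : Matrix.unitaryGroup (Fin n) ℂ × Pt n => act x.1.1 x.2 := by
  unfold act zc Matrix.mulVec dotProduct
  have h : ∀ i j : Fin n, Continuous fun x : Matrix.unitaryGroup (Fin n) ℂ × Pt n => x.1.1 i j :=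
    fun i j => (continuous_subtype_val.comp continuous_fst).matrix_elem i j
  have hz : ∀ j : Fin n, Continuous fun x : Matrix.unitaryGroup (Fin n) ℂ × Pt n =>
      (⟨x.2.1 j, x.2.2.1 j⟩ : ℂ) := fun j => by
    have : (fun x : Matrix.unitaryGroup (Fin n) ℂ × Pt n => (⟨x.2.1 j, x.2.2.1 j⟩ : ℂ)) =
      fun x => ((x.2.1 j : ℝ) : ℂ) + ((x.2.2.1 j : ℝ) : ℂ) * Complex.I := by
      funext x; apply Complex.ext <;> simp
    rw [this]
    fun_prop
  refine Continuous.prodMk (continuous_pi fun i => ?_) (Continuous.prodMk (continuous_pi fun i => ?_) (by fun_prop))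
  · exact Complex.continuous_re.comp (continuous_finsetSum _ fun j _ => (h i j).mul (hz j))
  · exact Complex.continuous_im.comp (continuous_finsetSum _ fun j _ => (h i j).mul (hz j))

end HeisAux

namespace HeisAux

instance msU (n : ℕ) : MeasurableSpace (Matrix.unitaryGroup (Fin n) ℂ) := borel _
instance bsU (n : ℕ) : BorelSpace (Matrix.unitaryGroup (Fin n) ℂ) := ⟨rfl⟩

def μU (n : ℕ) : Measure (Matrix.unitaryGroup (Fin n) ℂ) :=
  (Measure.haarMeasure (⊤ : TopologicalSpace.PositiveCompacts (Matrix.unitaryGroup (Fin n) ℂ))).inv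

instance μU_prob (n : ℕ) : IsProbabilityMeasure (μU n) := by
  have h : IsProbabilityMeasure (Measure.haarMeasure
      (⊤ : TopologicalSpace.PositiveCompacts (Matrix.unitaryGroup (Fin n) ℂ))) :=
    ⟨Measure.haarMeasure_self⟩
  unfold μU Measure.inv
  exact Measure.isProbabilityMeasure_map measurable_inv.aemeasurable

instance μU_right (n : ℕ) : (μU n).IsMulRightInvariant := by
  unfold μU; infer_instance

/-- average of a function over the unitary group -/
def avg {n : ℕ} (φ : Pt n → ℝ) (p : Pt n) : ℝ := ∫ U, φ (act U.1 p) ∂(μU n)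

lemma avg_inv {n : ℕ} (φ : Pt n → ℝ) (V : Matrix.unitaryGroup (Fin n) ℂ) (p : Pt n) :
    avg φ (act V.1 p) = avg φ p := by
  unfold avg
  simp only [act_act]
  exact integral_mul_right_eq_self (μ := μU n)
    (fun U : Matrix.unitaryGroup (Fin n) ℂ => φ (act U.1 p)) V

lemma fubini {n : ℕ} (f : Pt n → ℝ) (hf : LocallyIntegrable f volume)
    (H : Matrix.unitaryGroup (Fin n) ℂ → Pt n → ℝ)
    (hH : Continuous fun x : Matrix.unitaryGroup (Fin n) ℂ × Pt n => H x.1 x.2)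
    (C : Set (Pt n)) (hC : IsCompact C) (h0 : ∀ U, ∀ p ∉ C, H U p = 0) :
    Integrable (fun p => f p * ∫ U, H U p ∂(μU n)) volume ∧
    Integrable (fun U => ∫ p, f p * H U p) (μU n) ∧
    ∫ p, f p * ∫ U, H U p ∂(μU n) = ∫ U, (∫ p, f p * H U p) ∂(μU n) := by
  obtain ⟨B, hB⟩ := (isCompact_univ.prod hC).exists_bound_of_continuousOn hH.continuousOn
  have hB' : ∀ U p, ‖H U p‖ ≤ max B 0 := by
    intro U p
    by_cases hp : p ∈ C
    · exact (hB (U, p) ⟨trivial, hp⟩).trans (le_max_left _ _)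
    · rw [h0 U p hp, norm_zero]; exact le_max_right _ _
  have hfi : Integrable (C.indicator f) volume :=
    (integrable_indicator_iff hC.measurableSet).2 (hf.integrableOn_isCompact hC)
  have hprod : Integrable (fun x : Pt n × Matrix.unitaryGroup (Fin n) ℂ => f x.1 * H x.2 x.1)
      (volume.prod (μU n)) := by
    have h1 : Integrable (fun x : Pt n × Matrix.unitaryGroup (Fin n) ℂ =>
        C.indicator f x.1 * H x.2 x.1) (volume.prod (μU n)) :=
      (hfi.comp_fst (μU n)).mul_bdd (c := max B 0)
        (hH.comp continuous_swap).aestronglyMeasurable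
        (Eventually.of_forall fun x => hB' _ _)
    refine h1.congr (Eventually.of_forall fun x => ?_)
    by_cases hp : x.1 ∈ C
    · simp [hp]
    · simp [hp, h0 x.2 x.1 hp]
  refine ⟨?_, ?_, ?_⟩
  · have := hprod.integral_prod_left
    simpa only [integral_const_mul] using this
  · exact hprod.integral_prod_right
  · simp only [← integral_const_mul]
    exact integral_integral_swap (f := fun p U => f p * H U p) hprod

lemma exists_compact_act {n : ℕ} {φ : Pt n → ℝ} (hφ : HasCompactSupport φ) :
    ∃ C : Set (Pt n), IsCompact C ∧ ∀ (U : Matrix.unitaryGroup (Fin n) ℂ), ∀ p ∉ C,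
      act U.1 p ∉ tsupport φ := by
  refine ⟨(fun x : Matrix.unitaryGroup (Fin n) ℂ × Pt n => act x.1.1 x.2) ''
    (Set.univ ×ˢ tsupport φ), (isCompact_univ.prod hφ).image continuous_act, ?_⟩
  intro U p hp h
  exact hp ⟨(U⁻¹, act U.1 p), ⟨trivial, h⟩, act_inv_act U p⟩

lemma contDiff_act {n : ℕ} :
    ContDiff ℝ (⊤ : ℕ∞) fun x : Pt n × (Fin n → Fin n → ℂ) => act (-x.2 : Fin n → Fin n → ℂ) x.1 := by
  unfold act zc Matrix.mulVec dotProduct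
  have h : ∀ i j : Fin n, ContDiff ℝ (⊤ : ℕ∞)
      fun x : Pt n × (Fin n → Fin n → ℂ) => (-x.2 : Fin n → Fin n → ℂ) i j :=
    fun i j => by simp only [Pi.neg_apply]; fun_prop
  have hz : ∀ j : Fin n, ContDiff ℝ (⊤ : ℕ∞) fun x : Pt n × (Fin n → Fin n → ℂ) =>
      (⟨x.1.1 j, x.1.2.1 j⟩ : ℂ) := fun j => by
    have : (fun x : Pt n × (Fin n → Fin n → ℂ) => (⟨x.1.1 j, x.1.2.1 j⟩ : ℂ)) =
      fun x => Complex.ofRealCLM (x.1.1 j) + Complex.ofRealCLM (x.1.2.1 j) * Complex.I := by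
      funext x; apply Complex.ext <;> simp
    rw [this]
    fun_prop
  refine ContDiff.prodMk (contDiff_pi.2 fun i => ?_)
    (ContDiff.prodMk (contDiff_pi.2 fun i => ?_) (by fun_prop))
  · exact Complex.reCLM.contDiff.comp (ContDiff.sum fun j _ => (h i j).mul (hz j))
  · exact Complex.imCLM.contDiff.comp (ContDiff.sum fun j _ => (h i j).mul (hz j))

lemma contDiff_avg {n : ℕ} {φ : Pt n → ℝ} (h : ContDiff ℝ (⊤ : ℕ∞) φ) :
    ContDiff ℝ (⊤ : ℕ∞) (avg φ) := by
  let V := Fin n → Fin n → ℂ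
  let ι : Matrix.unitaryGroup (Fin n) ℂ → V := fun U => U.1
  have hι : Continuous ι := continuous_subtype_val
  have hιm : Measurable ι := hι.measurable
  let ν : Measure V := (μU n).map ι
  have hν : IsProbabilityMeasure ν := Measure.isProbabilityMeasure_map hιm.aemeasurable
  let χ : ContDiffBump (0 : V) := ⟨1, 2, one_pos, one_lt_two⟩
  let g : Pt n → V → ℝ := fun p A => χ A * φ (act (-A : V) p)
  have hχ1 : ∀ U, χ (-(ι U)) = 1 := by
    intro U
    apply χ.one_of_mem_closedBall
    rw [mem_closedBall_zero_iff, norm_neg]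
    change ‖ι U‖ ≤ 1
    refine (pi_norm_le_iff_of_nonneg zero_le_one).2 fun i => ?_
    refine (pi_norm_le_iff_of_nonneg zero_le_one).2 fun j => ?_
    exact entry_norm_bound_of_unitary U.2 i j
  have hg : ContDiff ℝ (⊤ : ℕ∞) (Function.uncurry g) :=
    (χ.contDiff.comp contDiff_snd).mul (h.comp contDiff_act)
  have key := contDiffOn_convolution_right_with_param_comp (𝕜 := ℝ) (μ := ν) (n := ⊤)
    (ContinuousLinearMap.mul ℝ ℝ) (s := Set.univ) (v := fun _ : Pt n => (0:V)) contDiffOn_const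
    (f := fun _ : V => (1:ℝ)) (g := g) (k := tsupport χ) isOpen_univ χ.hasCompactSupport
    (fun p x _ hx => by simp [g, image_eq_zero_of_notMem_tsupport hx])
    (locallyIntegrable_const _) hg.contDiffOn
  rw [contDiffOn_univ] at key
  convert key using 1
  funext p
  have hc : Continuous fun t : V => g p (0 - t) :=
    hg.continuous.comp (by fun_prop : Continuous fun t : V => (p, 0 - t))
  simp only [convolution, ContinuousLinearMap.mul_apply', one_mul]
  rw [integral_map hιm.aemeasurable hc.aestronglyMeasurable]
  unfold avg
  refine integral_congr_ae (Eventually.of_forall fun U => ?_)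
  have e2 : (-(-(ι U)) : V) = U.1 := neg_neg (ι U)
  simp only [g, zero_sub, hχ1, one_mul, e2]

lemma testFun_avg {n : ℕ} {φ : Pt n → ℝ} (h : TestFun n φ) : TestFun n (avg φ) := by
  refine ⟨contDiff_avg h.1, ?_⟩
  obtain ⟨C, hC, hCz⟩ := exists_compact_act h.2
  refine HasCompactSupport.intro hC fun p hp => ?_
  unfold avg
  simp [fun U => image_eq_zero_of_notMem_tsupport (hCz U p hp)]

lemma continuous_actC {n : ℕ} :
    Continuous fun U : Matrix.unitaryGroup (Fin n) ℂ => actC U.1 := by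
  rw [continuous_clm_apply]
  intro p
  exact continuous_act.comp (by fun_prop : Continuous fun U => (U, p))

lemma fderiv_act {n : ℕ} {φ : Pt n → ℝ} (h : TestFun n φ) (U : Matrix.unitaryGroup (Fin n) ℂ)
    (p : Pt n) : HasFDerivAt (fun q => φ (act U.1 q))
      ((fderiv ℝ φ (act U.1 p)).comp (actC U.1)) p :=
  ((tf_diff h) (act U.1 p)).hasFDerivAt.comp p ((actC U.1).hasFDerivAt (x := p))

lemma continuous_fderiv_act {n : ℕ} {φ : Pt n → ℝ} (h : TestFun n φ) :
    Continuous fun x : Matrix.unitaryGroup (Fin n) ℂ × Pt n =>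
      (fderiv ℝ φ (act x.1.1 x.2)).comp (actC x.1.1) := by
  have h1 : Continuous (fderiv ℝ φ) := h.1.continuous_fderiv (by simp)
  exact (h1.comp continuous_act).clm_comp (continuous_actC.comp continuous_fst)

lemma fderiv_avg {n : ℕ} {φ : Pt n → ℝ} (h : TestFun n φ) (p v : Pt n) :
    Integrable (fun U => fderiv ℝ (fun q => φ (act U.1 q)) p v) (μU n) ∧
    fderiv ℝ (avg φ) p v = ∫ U, fderiv ℝ (fun q => φ (act U.1 q)) p v ∂(μU n) := by
  have hcF := continuous_fderiv_act h
  have hcF' : ∀ p, Continuous fun U : Matrix.unitaryGroup (Fin n) ℂ =>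
      (fderiv ℝ φ (act U.1 p)).comp (actC U.1) := fun p =>
    hcF.comp (by fun_prop : Continuous fun U => (U, p))
  have hc0 : ∀ p, Continuous fun U : Matrix.unitaryGroup (Fin n) ℂ => φ (act U.1 p) := fun p =>
    (h.1.continuous.comp continuous_act).comp (by fun_prop : Continuous fun U => (U, p))
  obtain ⟨B, hB⟩ := (isCompact_univ.prod (isCompact_closedBall p 1)).exists_bound_of_continuousOn
    hcF.continuousOn
  have key := hasFDerivAt_integral_of_dominated_of_fderiv_le (μ := μU n) (𝕜 := ℝ)
    (F := fun q U => φ (act U.1 q)) (F' := fun q U => (fderiv ℝ φ (act U.1 q)).comp (actC U.1))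
    (x₀ := p) (bound := fun _ => B) (s := Metric.closedBall p 1)
    (Metric.closedBall_mem_nhds p one_pos)
    (Eventually.of_forall fun q => (hc0 q).aestronglyMeasurable)
    ((hc0 p).integrable_of_hasCompactSupport (HasCompactSupport.of_compactSpace _))
    (hcF' p).aestronglyMeasurable
    (Eventually.of_forall fun U q hq => hB (U, q) ⟨trivial, hq⟩)
    (integrable_const _)
    (Eventually.of_forall fun U q _ => fderiv_act h U q)
  have hint : Integrable (fun U : Matrix.unitaryGroup (Fin n) ℂ =>
      (fderiv ℝ φ (act U.1 p)).comp (actC U.1)) (μU n) :=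
    (hcF' p).integrable_of_hasCompactSupport (HasCompactSupport.of_compactSpace _)
  have e : ∀ U : Matrix.unitaryGroup (Fin n) ℂ, fderiv ℝ (fun q => φ (act U.1 q)) p v =
    ((fderiv ℝ φ (act U.1 p)).comp (actC U.1)) v := fun U => by rw [(fderiv_act h U p).fderiv]
  simp only [e]
  refine ⟨hint.apply_continuousLinearMap v, ?_⟩
  rw [show fderiv ℝ (avg φ) p = _ from key.fderiv]
  exact ContinuousLinearMap.integral_apply hint v

lemma Xd_avg {n : ℕ} {φ : Pt n → ℝ} (h : TestFun n φ) (j : Fin n) (p : Pt n) :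
    Xd n j (avg φ) p = ∫ U, Xd n j (fun q => φ (act U.1 q)) p ∂(μU n) := by
  obtain ⟨i1, e1⟩ := fderiv_avg h p (ex n j)
  obtain ⟨i2, e2⟩ := fderiv_avg h p (et n)
  simp only [Xd, e1, e2]
  rw [integral_add i1 (i2.const_mul _), integral_const_mul]

lemma Yd_avg {n : ℕ} {φ : Pt n → ℝ} (h : TestFun n φ) (j : Fin n) (p : Pt n) :
    Yd n j (avg φ) p = ∫ U, Yd n j (fun q => φ (act U.1 q)) p ∂(μU n) := by
  obtain ⟨i1, e1⟩ := fderiv_avg h p (ey n j)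
  obtain ⟨i2, e2⟩ := fderiv_avg h p (et n)
  simp only [Yd, e1, e2]
  rw [integral_sub i1 (i2.const_mul _), integral_const_mul]

lemma continuous_Xd_act {n : ℕ} {φ : Pt n → ℝ} (h : TestFun n φ) (j : Fin n) :
    Continuous fun x : Matrix.unitaryGroup (Fin n) ℂ × Pt n =>
      Xd n j (fun q => φ (act x.1.1 q)) x.2 := by
  have hcF := continuous_fderiv_act h
  simp only [Xd, (fderiv_act h _ _).fderiv]
  exact (hcF.clm_apply continuous_const).add
    ((by fun_prop : Continuous fun x : Matrix.unitaryGroup (Fin n) ℂ × Pt n =>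
      2 * x.2.2.1 j).mul (hcF.clm_apply continuous_const))

lemma continuous_Yd_act {n : ℕ} {φ : Pt n → ℝ} (h : TestFun n φ) (j : Fin n) :
    Continuous fun x : Matrix.unitaryGroup (Fin n) ℂ × Pt n =>
      Yd n j (fun q => φ (act x.1.1 q)) x.2 := by
  have hcF := continuous_fderiv_act h
  simp only [Yd, (fderiv_act h _ _).fderiv]
  exact (hcF.clm_apply continuous_const).sub
    ((by fun_prop : Continuous fun x : Matrix.unitaryGroup (Fin n) ℂ × Pt n =>
      2 * x.2.1 j).mul (hcF.clm_apply continuous_const))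

end HeisAux

namespace HeisAux

lemma mul_test_integrable {n : ℕ} {f ψ : Pt n → ℝ} (hf : LocallyIntegrable f volume)
    (h : TestFun n ψ) : Integrable (fun p => f p * ψ p) volume := by
  have := hf.integrable_smul_right_of_hasCompactSupport h.1.continuous h.2
  simpa only [smul_eq_mul] using this

lemma gDot_kohn {n : ℕ} {u : Pt n → ℝ} {G : Pt n → (Fin n → ℝ) × (Fin n → ℝ)}
    (hG : HasWeakHGrad n u G) (hu : LocallyIntegrable u volume) {φ : Pt n → ℝ}
    (h : TestFun n φ) : ∫ p, gDot n G φ p = -∫ p, u p * kohn n φ p := by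
  have l1 : ∀ j, LocallyIntegrable (fun p => (G p).1 j) volume :=
    fun j => (hG.1 j).1.locallyIntegrable (by norm_num)
  have l2 : ∀ j, LocallyIntegrable (fun p => (G p).2 j) volume :=
    fun j => (hG.1 j).2.locallyIntegrable (by norm_num)
  have i1 := fun j => mul_test_integrable (l1 j) (testFun_Xd h j)
  have i2 := fun j => mul_test_integrable (l2 j) (testFun_Yd h j)
  have k1 := fun j => mul_test_integrable hu (testFun_Xd (testFun_Xd h j) j)
  have k2 := fun j => mul_test_integrable hu (testFun_Yd (testFun_Yd h j) j)
  unfold gDot kohn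
  simp only [Finset.mul_sum, mul_add]
  rw [integral_finsetSum _ fun j _ => (i1 j).fun_add (i2 j),
    integral_finsetSum _ fun j _ => (k1 j).fun_add (k2 j), ← Finset.sum_neg_distrib]
  refine Finset.sum_congr rfl fun j _ => ?_
  rw [integral_add (i1 j) (i2 j), integral_add (k1 j) (k2 j),
    (hG.2 _ (testFun_Xd h j) j).1, (hG.2 _ (testFun_Yd h j) j).2]
  ring

lemma gDot_act {n : ℕ} {u : Pt n → ℝ} {G : Pt n → (Fin n → ℝ) × (Fin n → ℝ)}
    (hG : HasWeakHGrad n u G) (hu : LocallyIntegrable u volume) (hc : IsCyl n u) {φ : Pt n → ℝ}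
    (h : TestFun n φ) (U : Matrix.unitaryGroup (Fin n) ℂ) :
    ∫ p, gDot n G (fun q => φ (act U.1 q)) p = ∫ p, gDot n G φ p := by
  rw [gDot_kohn hG hu h, gDot_kohn hG hu (testFun_act h U),
    ← integral_act U (fun p => u p * kohn n φ p)]
  simp only [kohn_act h U, cyl_act hc]

lemma gDot_avg {n : ℕ} {u : Pt n → ℝ} {G : Pt n → (Fin n → ℝ) × (Fin n → ℝ)}
    (hG : HasWeakHGrad n u G) (hu : LocallyIntegrable u volume) (hc : IsCyl n u) {φ : Pt n → ℝ}
    (h : TestFun n φ) : ∫ p, gDot n G (avg φ) p = ∫ p, gDot n G φ p := by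
  have l1 : ∀ j, LocallyIntegrable (fun p => (G p).1 j) volume :=
    fun j => (hG.1 j).1.locallyIntegrable (by norm_num)
  have l2 : ∀ j, LocallyIntegrable (fun p => (G p).2 j) volume :=
    fun j => (hG.1 j).2.locallyIntegrable (by norm_num)
  obtain ⟨C, hC, hCz⟩ := exists_compact_act h.2
  have hz : ∀ U : Matrix.unitaryGroup (Fin n) ℂ, ∀ p ∉ C, fderiv ℝ (fun q => φ (act U.1 q)) p = 0 := by
    intro U p hp
    have h0 : fderiv ℝ φ (act U.1 p) = 0 := by
      by_contra hne
      exact hCz U p hp (support_fderiv_subset ℝ hne)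
    rw [(fderiv_act h U p).fderiv, h0, ContinuousLinearMap.zero_comp]
  have f1 := fun j => fubini _ (l1 j) (fun U p => Xd n j (fun q => φ (act U.1 q)) p)
    (continuous_Xd_act h j) C hC (fun U p hp => by simp [Xd, hz U p hp])
  have f2 := fun j => fubini _ (l2 j) (fun U p => Yd n j (fun q => φ (act U.1 q)) p)
    (continuous_Yd_act h j) C hC (fun U p hp => by simp [Yd, hz U p hp])
  have e : ∫ p, gDot n G (avg φ) p =
      ∫ U, (∫ p, gDot n G (fun q => φ (act U.1 q)) p) ∂(μU n) := by
    have e1 : ∀ U : Matrix.unitaryGroup (Fin n) ℂ, ∫ p, gDot n G (fun q => φ (act U.1 q)) p =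
        ∑ j, ((∫ p, (G p).1 j * Xd n j (fun q => φ (act U.1 q)) p) +
          ∫ p, (G p).2 j * Yd n j (fun q => φ (act U.1 q)) p) := by
      intro U
      have i1 := fun j => mul_test_integrable (l1 j) (testFun_Xd (testFun_act h U) j)
      have i2 := fun j => mul_test_integrable (l2 j) (testFun_Yd (testFun_act h U) j)
      unfold gDot
      rw [integral_finsetSum _ fun j _ => (i1 j).fun_add (i2 j)]
      exact Finset.sum_congr rfl fun j _ => integral_add (i1 j) (i2 j)
    simp only [e1]
    rw [integral_finsetSum _ fun j _ => (f1 j).2.1.fun_add (f2 j).2.1]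
    simp only [gDot, Xd_avg h, Yd_avg h]
    rw [integral_finsetSum _ fun j _ => (f1 j).1.fun_add (f2 j).1]
    refine Finset.sum_congr rfl fun j _ => ?_
    rw [integral_add (f1 j).1 (f2 j).1, integral_add (f1 j).2.1 (f2 j).2.1, (f1 j).2.2,
      (f2 j).2.2]
  rw [e]
  simp only [gDot_act hG hu hc h]
  simp

lemma rhs_avg {n : ℕ} {f : Pt n → ℝ} (hf : LocallyIntegrable f volume)
    (hinv : ∀ (U : Matrix.unitaryGroup (Fin n) ℂ) p, f (act U.1 p) = f p) {φ : Pt n → ℝ}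
    (h : TestFun n φ) : ∫ p, f p * avg φ p = ∫ p, f p * φ p := by
  obtain ⟨C, hC, hCz⟩ := exists_compact_act h.2
  have f1 := fubini f hf (fun U p => φ (act U.1 p)) (h.1.continuous.comp continuous_act) C hC
    (fun U p hp => image_eq_zero_of_notMem_tsupport (hCz U p hp))
  unfold avg
  rw [f1.2.2]
  have : ∀ U : Matrix.unitaryGroup (Fin n) ℂ, ∫ p, f p * φ (act U.1 p) = ∫ p, f p * φ p := by
    intro U
    rw [← integral_act U (fun p => f p * φ p)]
    simp only [hinv]
  simp [this]

lemma znorm_pos_ae {n : ℕ} (hn : 1 ≤ n) : ∀ᵐ p : Pt n, 0 < znorm n p := by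
  let j : Fin n := ⟨0, hn⟩
  let S : Submodule ℝ (Pt n) :=
    LinearMap.ker ((LinearMap.proj j : (Fin n → ℝ) →ₗ[ℝ] ℝ).comp (LinearMap.fst ℝ _ _))
  have hS : S ≠ ⊤ := by
    intro hS
    have : ex n j ∈ S := by rw [hS]; trivial
    simp [S, ex] at this
  have h0 := Measure.addHaar_submodule (volume : Measure (Pt n)) S hS
  rw [ae_iff]
  refine measure_mono_null ?_ h0
  intro p hp
  have hp1 : ¬ 0 < znorm n p := hp
  unfold znorm at hp1
  rw [Real.sqrt_pos, not_lt] at hp1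
  have n2 : 0 ≤ ∑ j, (p.2.1 j) ^ 2 := Finset.sum_nonneg fun j _ => sq_nonneg _
  have := Finset.single_le_sum (f := fun j => (p.1 j) ^ 2) (fun i _ => sq_nonneg _)
    (Finset.mem_univ j)
  have h3 : p.1 j ^ 2 = 0 := le_antisymm (by linarith) (sq_nonneg _)
  change p.1 j = 0
  exact pow_eq_zero_iff two_ne_zero |>.1 h3

lemma K_meas {n : ℕ} (hn : 1 ≤ n) (K : Pt n → ℝ) (Kt : ℝ → ℝ → ℝ)
    (hKrep : ∀ p : Pt n, K p = Kt (znorm n p) p.2.2)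
    (hKholder : LocHolderOn Kt (Set.Ioi 0 ×ˢ Set.univ)) : AEStronglyMeasurable K volume := by
  have hc : ContinuousOn (fun q : ℝ × ℝ => Kt q.1 q.2) (Set.Ioi 0 ×ˢ Set.univ) := by
    intro x hx
    obtain ⟨t, ht, C, α, hα, hH⟩ := hKholder x hx
    have h1 := hH.continuousOn hα x (mem_of_mem_nhdsWithin hx ht)
    exact h1.mono_of_mem_nhdsWithin ht
  have hS : IsOpen {p : Pt n | 0 < znorm n p} := isOpen_lt continuous_const (continuous_znorm n)
  have hK : ContinuousOn K {p : Pt n | 0 < znorm n p} := by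
    have : K = (fun q : ℝ × ℝ => Kt q.1 q.2) ∘ fun p : Pt n => (znorm n p, p.2.2) := by
      funext p; exact hKrep p
    rw [this]
    refine hc.comp ((continuous_znorm n).prodMk (by fun_prop)).continuousOn ?_
    intro p hp
    exact ⟨hp, trivial⟩
  have h2 := hK.aestronglyMeasurable (μ := volume) hS.measurableSet
  rwa [Measure.restrict_eq_self_of_ae_mem (s := {p : Pt n | 0 < znorm n p}) (znorm_pos_ae hn)] at h2

lemma Qs_ge {n : ℕ} (hn : 1 ≤ n) : 2 ≤ Qs n := by
  have h : (1:ℝ) ≤ n := by exact_mod_cast hn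
  unfold Qs Qh
  rw [le_div_iff₀ (by linarith)]
  linarith

lemma rhs_loc {n : ℕ} (hn : 1 ≤ n) {K u : Pt n → ℝ} (hK : AEStronglyMeasurable K volume)
    (hKbd : ∃ C : ℝ, ∀ p : Pt n, |K p| ≤ C) (hupos : ∀ p : Pt n, 0 ≤ u p)
    (huLp : MemLp u (ENNReal.ofReal (Qs n)) volume) :
    LocallyIntegrable (fun p => K p * u p ^ (Qs n - 1)) volume := by
  obtain ⟨C, hC⟩ := hKbd
  have hq := Qs_ge hn
  have hi : Integrable (fun p => ‖u p‖ ^ Qs n) volume := by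
    have := huLp.integrable_norm_rpow (by simp; linarith) (by simp)
    rwa [ENNReal.toReal_ofReal (by linarith)] at this
  have hl : LocallyIntegrable (fun p => C * (1 + ‖u p‖ ^ Qs n)) volume :=
    ((locallyIntegrable_const (1:ℝ)).add hi.locallyIntegrable).smul C
  refine hl.mono ?_ (Eventually.of_forall fun p => ?_)
  · exact hK.mul (huLp.1.aemeasurable.pow_const _).aestronglyMeasurable
  · have hC0 : 0 ≤ C := (abs_nonneg _).trans (hC p)
    have hu := hupos p
    have hb : u p ^ (Qs n - 1) ≤ 1 + ‖u p‖ ^ Qs n := by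
      rw [Real.norm_of_nonneg hu]
      rcases le_total (u p) 1 with h1 | h1
      · have := Real.rpow_le_one hu h1 (by linarith : 0 ≤ Qs n - 1)
        have := Real.rpow_nonneg hu (Qs n)
        linarith
      · have := Real.rpow_le_rpow_of_exponent_le h1 (by linarith : Qs n - 1 ≤ Qs n)
        linarith
    have h0 := Real.rpow_nonneg hu (Qs n - 1)
    rw [norm_mul, Real.norm_of_nonneg h0, Real.norm_eq_abs (K p)]
    exact (mul_le_mul (hC p) hb h0 hC0).trans (le_abs_self _)

end HeisAux

/-- Lemma A.2: a nonnegative cylindrically symmetric weak solution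
with respect to cylindrically symmetric test functions is a weak solution with
respect to all test functions. -/
theorem weak_solution_cylindrical_tests_suffice (n : ℕ) (hn : 1 ≤ n)
    (K u : Pt n → ℝ) (Kt : ℝ → ℝ → ℝ)
    (hKbd : ∃ C : ℝ, ∀ p : Pt n, |K p| ≤ C)
    (hKrep : ∀ p : Pt n, K p = Kt (znorm n p) p.2.2)
    (hKholder : LocHolderOn Kt (Set.Ioi 0 ×ˢ Set.univ))
    (hupos : ∀ p : Pt n, 0 ≤ u p)
    (hucyl : IsCyl n u)
    (huLp : MemLp u (ENNReal.ofReal (Qs n)) volume)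
    (G : Pt n → (Fin n → ℝ) × (Fin n → ℝ))
    (hG : HasWeakHGrad n u G)
    (hweak : ∀ φ : Pt n → ℝ, TestFun n φ → IsCyl n φ →
        ∫ p : Pt n, gDot n G φ p = ∫ p : Pt n, K p * u p ^ (Qs n - 1) * φ p) :
    ∀ φ : Pt n → ℝ, TestFun n φ →
      ∫ p : Pt n, gDot n G φ p = ∫ p : Pt n, K p * u p ^ (Qs n - 1) * φ p := by
  intro φ hφ
  have hu : LocallyIntegrable u volume := huLp.locallyIntegrable (by
    have := HeisAux.Qs_ge hn
    rw [ENNReal.one_le_ofReal]; linarith)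
  have hK := HeisAux.K_meas hn K Kt hKrep hKholder
  have hf := HeisAux.rhs_loc hn hK hKbd hupos huLp
  have key := hweak (HeisAux.avg φ) (HeisAux.testFun_avg hφ)
    (HeisAux.isCyl_of_inv (HeisAux.avg_inv φ))
  rw [HeisAux.gDot_avg hG hu hucyl hφ] at key
  rw [key]
  refine HeisAux.rhs_avg hf (fun U p => ?_) hφ
  rw [HeisAux.cyl_act hucyl U p, HeisAux.cyl_act (⟨Kt, hKrep⟩ : IsCyl n K) U p]
end
end

section
/- For (x,y,t) ∈ ℝ^{2n+1} with z = x+iy, set D(z,t) = (t² + (1+|z|²)²)^{−(Q+2)/4}. Let γ = (γ₁,…,γ_n) ∈ ℝⁿ and τ = (τ₁,…,τ_n) ∈ ℝⁿ and define h(x,y,t) = D(z,t) · Σ_{i=1}^n [ γ_i ((1+|z|²) x_i − t y_i) + τ_i ((1+|z|²) y_i + t x_i) ]. If h is cylindrically symmetric (i.e. h(x,y,t) depends only on (|z|, t)), then γ_i = τ_i = 0 for every i = 1,…,n. -/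
open MeasureTheory Filter Topology

noncomputable section

open Heis
/-- symmetry step in Lemma 4.2: if
`h = D(z,t) Σᵢ [γᵢ((1+|z|²)xᵢ - t yᵢ) + τᵢ((1+|z|²)yᵢ + t xᵢ)]` is cylindrically
symmetric, then `γ = τ = 0`. -/
theorem cylindrical_kernel_coefficients_vanish (n : ℕ) (hn : 1 ≤ n)
    (γ τ : Fin n → ℝ)
    (h : IsCyl n (fun p : Pt n =>
        (p.2.2 ^ 2 + (1 + (znorm n p) ^ 2) ^ 2) ^ (-(Qh n + 2) / 4) *
          ∑ i, (γ i * ((1 + (znorm n p) ^ 2) * p.1 i - p.2.2 * p.2.1 i)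
            + τ i * ((1 + (znorm n p) ^ 2) * p.2.1 i + p.2.2 * p.1 i)))) :
    ∀ i : Fin n, γ i = 0 ∧ τ i = 0 := by
  obtain ⟨v, hv⟩ := h
  beta_reduce at hv
  have key : ∀ (a : ℝ), a ≠ 0 → ∀ b : ℝ, a * (2 * b) = a * (-(2 * b)) → b = 0 := by
    intro a ha b hb
    have := mul_left_cancel₀ ha hb
    linarith
  have hD : ((0 : ℝ) ^ 2 + (1 + (1 : ℝ) ^ 2) ^ 2) ^ (-(Qh n + 2) / 4) ≠ 0 :=
    (Real.rpow_pos_of_pos (by norm_num) _).ne'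
  have sq : ∀ (i : Fin n) (c : ℝ), c ^ 2 = 1 →
      ∑ j, ((Pi.single i c : Fin n → ℝ) j) ^ 2 = 1 := by
    intro i c hc
    rw [Finset.sum_eq_single i]
    · simpa using hc
    · intro j _ hj
      simp [hj]
    · simp
  have zx : ∀ (i : Fin n) (c : ℝ), c ^ 2 = 1 → znorm n (Pi.single i c, 0, 0) = 1 := by
    intro i c hc
    simp only [znorm]
    rw [sq i c hc]
    simp
  have zy : ∀ (i : Fin n) (c : ℝ), c ^ 2 = 1 → znorm n (0, Pi.single i c, 0) = 1 := by
    intro i c hc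
    simp only [znorm]
    rw [sq i c hc]
    simp
  have sm : ∀ (g : Fin n → ℝ) (i : Fin n) (c : ℝ),
      ∑ j, g j * ((1 + (1 : ℝ) ^ 2) * (Pi.single i c : Fin n → ℝ) j) = 2 * (g i * c) := by
    intro g i c
    rw [Finset.sum_eq_single i]
    · simp only [Pi.single_eq_same]
      ring
    · intro j _ hj
      simp [hj]
    · simp
  intro i
  constructor
  · have h1 := hv (Pi.single i 1, 0, 0)
    have h2 := hv (Pi.single i (-1), 0, 0)
    rw [zx i 1 (by norm_num)] at h1
    rw [zx i (-1) (by norm_num)] at h2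
    simp only [Pi.zero_apply, mul_zero, zero_mul, sub_zero, add_zero] at h1 h2
    rw [sm] at h1 h2
    refine key _ hD _ ?_
    simp only [mul_one, mul_neg] at h1 h2 ⊢
    exact h1.trans h2.symm
  · have h1 := hv (0, Pi.single i 1, 0)
    have h2 := hv (0, Pi.single i (-1), 0)
    rw [zy i 1 (by norm_num)] at h1
    rw [zy i (-1) (by norm_num)] at h2
    simp only [Pi.zero_apply, mul_zero, zero_mul, sub_zero, add_zero, zero_add] at h1 h2
    rw [sm] at h1 h2
    refine key _ hD _ ?_
    simp only [mul_one, mul_neg] at h1 h2 ⊢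
    exact h1.trans h2.symm
end
end

section
/- Let ω(z,t) = (Q−2)^{(Q−2)/2} ( t² + (1+|z|²)² )^{−(Q−2)/4} on ℝ^{2n+1}. Then ω is smooth, positive, and satisfies −Δ_{ℍⁿ}ω(z,t) = ω(z,t)^{Q*−1} at every point (z,t) ∈ ℝ^{2n+1}, where Q*−1 = (Q+2)/(Q−2). -/
open MeasureTheory Filter Topology

noncomputable section

open Heis

namespace HeisAux

/-- `f` is differentiable at `p` with derivative `d` in direction `v`. -/
def HD {n : ℕ} (v : Pt n) (f : Pt n → ℝ) (p : Pt n) (d : ℝ) : Prop :=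
  ∃ f' : Pt n →L[ℝ] ℝ, HasFDerivAt f f' p ∧ f' v = d

variable {n : ℕ} {v p : Pt n} {f g : Pt n → ℝ} {a b : ℝ}

lemma HD.add (hf : HD v f p a) (hg : HD v g p b) : HD v (fun q => f q + g q) p (a + b) := by
  obtain ⟨f', h1, rfl⟩ := hf
  obtain ⟨g', h2, rfl⟩ := hg
  exact ⟨f' + g', h1.add h2, rfl⟩

lemma HD.sub (hf : HD v f p a) (hg : HD v g p b) : HD v (fun q => f q - g q) p (a - b) := by
  obtain ⟨f', h1, rfl⟩ := hf
  obtain ⟨g', h2, rfl⟩ := hg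
  exact ⟨f' - g', h1.sub h2, rfl⟩

lemma HD.mul (hf : HD v f p a) (hg : HD v g p b) :
    HD v (fun q => f q * g q) p (f p * b + g p * a) := by
  obtain ⟨f', h1, rfl⟩ := hf
  obtain ⟨g', h2, rfl⟩ := hg
  exact ⟨_, h1.mul h2, by simp⟩

lemma HD.const (c : ℝ) : HD v (fun _ => c) p 0 := ⟨0, hasFDerivAt_const c p, rfl⟩

lemma HD.rpow (hf : HD v f p a) (h0 : f p ≠ 0) (s : ℝ) :
    HD v (fun q => f q ^ s) p (s * f p ^ (s - 1) * a) := by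
  obtain ⟨f', h1, rfl⟩ := hf
  exact ⟨_, h1.rpow_const (p := s) (Or.inl h0), by simp⟩

lemma HD.sum {F : Fin n → Pt n → ℝ} {A : Fin n → ℝ} (h : ∀ i, HD v (F i) p (A i)) :
    HD v (fun q => ∑ i, F i q) p (∑ i, A i) := by
  choose f' h1 h2 using h
  exact ⟨∑ i, f' i, HasFDerivAt.fun_sum (fun i _ => h1 i), by simp [h2]⟩

lemma HD.x (i : Fin n) : HD v (fun q => q.1 i) p (v.1 i) :=
  ⟨(ContinuousLinearMap.proj i).comp (ContinuousLinearMap.fst ℝ _ _),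
    ContinuousLinearMap.hasFDerivAt
      ((ContinuousLinearMap.proj (R := ℝ) (φ := fun _ : Fin n => ℝ) i).comp
        (ContinuousLinearMap.fst ℝ (Fin n → ℝ) ((Fin n → ℝ) × ℝ))), rfl⟩

lemma HD.y (i : Fin n) : HD v (fun q => q.2.1 i) p (v.2.1 i) :=
  ⟨_, ContinuousLinearMap.hasFDerivAt
      ((ContinuousLinearMap.proj (R := ℝ) (φ := fun _ : Fin n => ℝ) i).comp
        ((ContinuousLinearMap.fst ℝ (Fin n → ℝ) ℝ).comp
        (ContinuousLinearMap.snd ℝ (Fin n → ℝ) ((Fin n → ℝ) × ℝ)))), rfl⟩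

lemma HD.t : HD v (fun q => q.2.2) p v.2.2 :=
  ⟨_, ContinuousLinearMap.hasFDerivAt
      ((ContinuousLinearMap.snd ℝ (Fin n → ℝ) ℝ).comp
        (ContinuousLinearMap.snd ℝ (Fin n → ℝ) ((Fin n → ℝ) × ℝ))), rfl⟩

/-- X direction. -/
def vX (j : Fin n) (p : Pt n) : Pt n := (Pi.single j 1, 0, 2 * p.2.1 j)
/-- Y direction. -/
def vY (j : Fin n) (p : Pt n) : Pt n := (0, Pi.single j 1, -(2 * p.1 j))

lemma HD.Xd {j : Fin n} (h : HD (vX j p) f p a) : Xd n j f p = a := by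
  obtain ⟨f', h1, rfl⟩ := h
  have : vX j p = ex n j + (2 * p.2.1 j) • et n := by simp [vX, ex, et]
  rw [this, Heis.Xd, h1.fderiv]; simp

lemma HD.Yd {j : Fin n} (h : HD (vY j p) f p a) : Yd n j f p = a := by
  obtain ⟨f', h1, rfl⟩ := h
  have : vY j p = ey n j + (-(2 * p.1 j)) • et n := by simp [vY, ey, et]
  rw [this, Heis.Yd, h1.fderiv]; simp; ring

/-- `1 + |z|²` -/
def AA (p : Pt n) : ℝ := 1 + (∑ j, p.1 j * p.1 j + ∑ j, p.2.1 j * p.2.1 j)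
/-- the base -/
def PP (p : Pt n) : ℝ := p.2.2 * p.2.2 + AA p * AA p

lemma AA_pos (p : Pt n) : 0 < AA p := by
  have h1 := Finset.sum_nonneg (s := Finset.univ) (fun j _ => mul_self_nonneg (p.1 j))
  have h2 := Finset.sum_nonneg (s := Finset.univ) (fun j _ => mul_self_nonneg (p.2.1 j))
  unfold AA; linarith

lemma PP_pos (p : Pt n) : 0 < PP p := by
  have := AA_pos p
  have := mul_pos this this
  have := mul_self_nonneg p.2.2
  unfold PP; linarith

lemma HD.congr (h : HD v f p a) (e : a = b) : HD v f p b := e ▸ h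

lemma HD_AA : HD v AA p (2 * (∑ j, p.1 j * v.1 j + ∑ j, p.2.1 j * v.2.1 j)) := by
  refine HD.congr ((HD.const 1).add ((HD.sum fun j => (HD.x j).mul (HD.x j)).add
    (HD.sum fun j => (HD.y j).mul (HD.y j)))) ?_
  simp only [Finset.sum_add_distrib]; ring

lemma HD_PP : HD v PP p (2 * p.2.2 * v.2.2 +
    4 * AA p * (∑ j, p.1 j * v.1 j + ∑ j, p.2.1 j * v.2.1 j)) := by
  refine HD.congr ((HD.t.mul HD.t).add (HD_AA.mul HD_AA)) ?_
  ring

lemma omega_eq (p : Pt n) : omegaFun n p =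
    (2 * n : ℝ) ^ (n : ℝ) * PP p ^ (-(n : ℝ) / 2) := by
  have h : znorm n p ^ 2 = ∑ j, p.1 j * p.1 j + ∑ j, p.2.1 j * p.2.1 j := by
    rw [znorm, Real.sq_sqrt (by positivity)]; simp only [sq]
  rw [omegaFun, h]
  have e1 : Qh n - 2 = 2 * n := by unfold Qh; ring
  rw [e1]
  have e2 : (2 * n : ℝ) / 2 = n := by ring
  have e3 : -(2 * n : ℝ) / 4 = -n / 2 := by ring
  rw [e2, e3, sq, sq]; rfl

lemma HD_w (c s : ℝ) : HD v (fun q => c * PP q ^ s) p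
    (c * s * PP p ^ (s - 1) * (2 * p.2.2 * v.2.2 +
    4 * AA p * (∑ j, p.1 j * v.1 j + ∑ j, p.2.1 j * v.2.1 j))) := by
  refine HD.congr ((HD.const c).mul (HD_PP.rpow (PP_pos p).ne' s)) ?_
  ring

lemma Xd_w (c s : ℝ) (j : Fin n) : Xd n j (fun q => c * PP q ^ s) =
    fun p => (c * s * PP p ^ (s - 1)) * (4 * (p.2.2 * p.2.1 j + AA p * p.1 j)) := by
  funext p
  rw [(HD_w c s).Xd]; simp [vX, Pi.single_apply]; left; ring

lemma Yd_w (c s : ℝ) (j : Fin n) : Yd n j (fun q => c * PP q ^ s) =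
    fun p => (c * s * PP p ^ (s - 1)) * (4 * (AA p * p.2.1 j - p.2.2 * p.1 j)) := by
  funext p
  rw [(HD_w c s).Yd]; simp [vY, Pi.single_apply]; left; ring

lemma XX_w (c s : ℝ) (j : Fin n) (p : Pt n) : Xd n j (Xd n j (fun q => c * PP q ^ s)) p =
    c * s * PP p ^ (s - 1) * (4 * AA p + 8 * (p.1 j * p.1 j + p.2.1 j * p.2.1 j)) +
    c * s * (s - 1) * PP p ^ (s - 1 - 1) * (4 * (p.2.2 * p.2.1 j + AA p * p.1 j)) ^ 2 := by
  rw [Xd_w, ((HD_w (c * s) (s - 1)).mul ((HD.const 4).mul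
    ((HD.t.mul (HD.y j)).add (HD_AA.mul (HD.x j))))).Xd]
  simp [vX, Pi.single_apply]; ring

lemma YY_w (c s : ℝ) (j : Fin n) (p : Pt n) : Yd n j (Yd n j (fun q => c * PP q ^ s)) p =
    c * s * PP p ^ (s - 1) * (4 * AA p + 8 * (p.1 j * p.1 j + p.2.1 j * p.2.1 j)) +
    c * s * (s - 1) * PP p ^ (s - 1 - 1) * (4 * (AA p * p.2.1 j - p.2.2 * p.1 j)) ^ 2 := by
  rw [Yd_w, ((HD_w (c * s) (s - 1)).mul ((HD.const 4).mul
    ((HD_AA.mul (HD.y j)).sub (HD.t.mul (HD.x j))))).Yd]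
  simp [vY, Pi.single_apply]; ring

lemma kohn_w (c s : ℝ) (p : Pt n) : kohn n (fun q => c * PP q ^ s) p =
    c * s * PP p ^ (s - 1) * (8 * n * AA p + 16 * s * (AA p - 1)) := by
  have hP : PP p ^ (s - 1) = PP p ^ (s - 1 - 1) * PP p := by
    rw [← Real.rpow_add_one (PP_pos p).ne']; congr 1; ring
  have hr : ∑ j, (p.1 j * p.1 j + p.2.1 j * p.2.1 j) = AA p - 1 := by
    rw [Finset.sum_add_distrib]; unfold AA; ring
  have key : ∀ j, Xd n j (Xd n j (fun q => c * PP q ^ s)) p +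
      Yd n j (Yd n j (fun q => c * PP q ^ s)) p =
      c * s * PP p ^ (s - 1) * (8 * AA p) +
      c * s * PP p ^ (s - 1) * 16 * s * (p.1 j * p.1 j + p.2.1 j * p.2.1 j) := by
    intro j
    rw [XX_w, YY_w, hP]
    generalize PP p ^ (s - 1 - 1) = R
    unfold PP; ring
  unfold kohn
  rw [Finset.sum_congr rfl (fun j _ => key j), Finset.sum_add_distrib, Finset.sum_const, ← Finset.mul_sum, hr]
  simp; ring

end HeisAux

open HeisAux

/-- the standard bubble
`ω(z,t) = (Q-2)^{(Q-2)/2}(t² + (1+|z|²)²)^{-(Q-2)/4}` is smooth, positive, and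
solves `-Δ_{ℍⁿ}ω = ω^{Q*-1}` pointwise. -/
theorem omega_solves_critical_equation (n : ℕ) (hn : 1 ≤ n) :
    ContDiff ℝ (⊤ : ℕ∞) (omegaFun n) ∧ (∀ p : Pt n, 0 < omegaFun n p) ∧
      ∀ p : Pt n, -(kohn n (omegaFun n) p) = omegaFun n p ^ (Qs n - 1) := by
  have hn0 : (0 : ℝ) < n := by exact_mod_cast hn
  have hc : (0 : ℝ) < (2 * n : ℝ) ^ (n : ℝ) := by positivity
  have hw : omegaFun n = fun p => (2 * n : ℝ) ^ (n : ℝ) * PP p ^ (-(n : ℝ) / 2) :=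
    funext omega_eq
  refine ⟨?_, ?_, ?_⟩
  · rw [hw]
    refine contDiff_const.mul (ContDiff.rpow_const_of_ne ?_ fun p => (PP_pos p).ne')
    unfold PP AA
    fun_prop
  · intro p
    rw [hw]
    exact mul_pos hc (Real.rpow_pos_of_pos (PP_pos p) _)
  · intro p
    rw [hw, kohn_w]
    have e : Qs n - 1 = 1 + 2 / (n : ℝ) := by
      have e1 : Qh n - 2 = 2 * n := by unfold Qh; ring
      rw [Qs, e1, Qh]; field_simp; ring
    have h1 : ((2 * n : ℝ) ^ (n : ℝ)) ^ (1 + 2 / (n : ℝ)) =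
        (2 * n : ℝ) ^ (n : ℝ) * (2 * n) ^ 2 := by
      rw [Real.rpow_add hc, Real.rpow_one, ← Real.rpow_mul (by positivity)]
      congr 1
      rw [mul_div_cancel₀ _ hn0.ne']
      exact Real.rpow_two _
    have h2 : (PP p ^ (-(n : ℝ) / 2)) ^ (1 + 2 / (n : ℝ)) = PP p ^ (-(n : ℝ) / 2 - 1) := by
      rw [← Real.rpow_mul (PP_pos p).le]
      congr 1
      field_simp
      ring
    rw [e, Real.mul_rpow hc.le (Real.rpow_pos_of_pos (PP_pos p) _).le, h1, h2]
    ring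
end
end

section
/- Let k: ℝ^{2n+1} → ℝ be bounded and continuous with finite limit k(∞) = lim_{|(z,t)|→∞} k(z,t). Set Γ(μ,s) = (1/Q*) ∫_{ℝ^{2n+1}} k(μz, μ²t+s) ω(z,t)^{Q*} dz dt for μ > 0, s ∈ ℝ, and b₀ = (1/Q*) ∫_{ℝ^{2n+1}} ω^{Q*} dz dt. Then Γ(μ,s) → b₀ k(∞) as (μ,s) → ∞, i.e. for every ε > 0 there exists R > 0 such that |Γ(μ,s) − b₀ k(∞)| < ε whenever μ > 0, s ∈ ℝ and μ + |s| > R. -/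
open MeasureTheory Filter Topology

noncomputable section

open Heis
theorem Heis_omega_pow (n : ℕ) (hn : 1 ≤ n) (p : Pt n) :
    omegaFun n p ^ Qs n = ((Qh n - 2) ^ ((Qh n - 2) / 2)) ^ Qs n *
      ((p.2.2 ^ 2 + (1 + (∑ j, (p.1 j) ^ 2 + ∑ j, (p.2.1 j) ^ 2)) ^ 2) ^ (n + 1))⁻¹ := by
  have hn' : (0 : ℝ) < n := by exact_mod_cast hn
  have hr : 0 ≤ ∑ j, (p.1 j) ^ 2 + ∑ j, (p.2.1 j) ^ 2 := by positivity
  have hX : 0 ≤ p.2.2 ^ 2 + (1 + (∑ j, (p.1 j) ^ 2 + ∑ j, (p.2.1 j) ^ 2)) ^ 2 := by positivity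
  have hq : (0 : ℝ) ≤ Qh n - 2 := by unfold Qh; linarith
  unfold omegaFun znorm
  rw [Real.sq_sqrt hr, Real.mul_rpow (Real.rpow_nonneg hq _) (Real.rpow_nonneg hX _),
    ← Real.rpow_mul hX]
  have : -(Qh n - 2) / 4 * Qs n = -((n + 1 : ℕ) : ℝ) := by
    unfold Qs Qh
    push_cast
    have h2 : (2 * (n : ℝ) + 2 - 2) = 2 * n := by ring
    rw [h2]
    field_simp
    ring
  rw [this, Real.rpow_neg hX, Real.rpow_natCast]

theorem Heis_integrable (n : ℕ) (hn : 1 ≤ n) :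
    Integrable (fun p : Pt n => omegaFun n p ^ Qs n) := by
  simp_rw [Heis_omega_pow n hn]
  apply Integrable.const_mul
  have h1 : Integrable (fun x : Fin n → ℝ => ∏ j, (1 + x j ^ 2)⁻¹) :=
    Integrable.fintype_prod (f := fun _ (x : ℝ) => (1 + x ^ 2)⁻¹)
      (fun _ => integrable_inv_one_add_sq)
  have h2 : Integrable (fun p : Pt n => (∏ j, (1 + p.1 j ^ 2)⁻¹) *
      ((∏ j, (1 + p.2.1 j ^ 2)⁻¹) * (1 + p.2.2 ^ 2)⁻¹)) :=
    h1.mul_prod (h1.mul_prod integrable_inv_one_add_sq)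
  refine h2.mono' ?_ ?_
  · exact Measurable.aestronglyMeasurable (by fun_prop)
  · refine ae_of_all _ fun p => ?_
    have ha : 0 ≤ ∑ j, (p.1 j) ^ 2 := by positivity
    have hb : 0 ≤ ∑ j, (p.2.1 j) ^ 2 := by positivity
    set r := ∑ j, (p.1 j) ^ 2 + ∑ j, (p.2.1 j) ^ 2 with hr
    have hr0 : 0 ≤ r := by positivity
    rw [Real.norm_of_nonneg (by positivity)]
    rw [Finset.prod_inv_distrib, Finset.prod_inv_distrib, ← mul_inv, ← mul_inv]
    have e1 : ∏ j, (1 + p.1 j ^ 2) ≤ (1 + r) ^ n := by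
      calc _ ≤ ∏ j : Fin n, (1 + r) := by
            apply Finset.prod_le_prod
            · intros; positivity
            · intro i _
              have := Finset.single_le_sum (f := fun j => (p.1 j) ^ 2)
                (fun j _ => sq_nonneg _) (Finset.mem_univ i)
              linarith
        _ = _ := by simp
    have e2 : ∏ j, (1 + p.2.1 j ^ 2) ≤ (1 + r) ^ n := by
      calc _ ≤ ∏ j : Fin n, (1 + r) := by
            apply Finset.prod_le_prod
            · intros; positivity
            · intro i _
              have := Finset.single_le_sum (f := fun j => (p.2.1 j) ^ 2)
                (fun j _ => sq_nonneg _) (Finset.mem_univ i)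
              linarith
        _ = _ := by simp
    have p1 : 0 < ∏ j, (1 + p.1 j ^ 2) := Finset.prod_pos fun _ _ => by positivity
    have p2 : 0 < ∏ j, (1 + p.2.1 j ^ 2) := Finset.prod_pos fun _ _ => by positivity
    apply inv_anti₀ (by positivity)
    calc _ ≤ (1 + r) ^ n * ((1 + r) ^ n * (1 + p.2.2 ^ 2)) := by gcongr
      _ = ((1 + r) ^ 2) ^ n * (1 + p.2.2 ^ 2) := by rw [← pow_mul, mul_comm 2 n, pow_mul]; ring
      _ ≤ (p.2.2 ^ 2 + (1 + r) ^ 2) ^ n * (p.2.2 ^ 2 + (1 + r) ^ 2) := by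
          have g1 : (1 + r) ^ 2 ≤ p.2.2 ^ 2 + (1 + r) ^ 2 := by linarith [sq_nonneg p.2.2]
          have g2 : 1 + p.2.2 ^ 2 ≤ p.2.2 ^ 2 + (1 + r) ^ 2 := by nlinarith
          exact mul_le_mul (pow_le_pow_left₀ (by positivity) g1 n) g2 (by positivity)
            (by positivity)
      _ = _ := (pow_succ _ _).symm

theorem Heis_ae (n : ℕ) (j : Fin n) : ∀ᵐ p : Pt n, p.1 j ≠ 0 := by
  have h0 : ∀ᵐ x : ℝ, x ≠ 0 := by simp [ae_iff]
  have h1 : ∀ᵐ x : Fin n → ℝ, x j ≠ 0 :=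
    (Measure.quasiMeasurePreserving_eval (fun _ : Fin n => (volume : Measure ℝ)) j).ae h0
  exact (Measure.quasiMeasurePreserving_fst
    (μ := (volume : Measure (Fin n → ℝ))) (ν := (volume : Measure ((Fin n → ℝ) × ℝ)))).ae h1

theorem Heis_scale (n : ℕ) (j : Fin n) (p : Pt n) (hp : p.1 j ≠ 0) :
    Tendsto (fun q : ℝ × ℝ => scalePt n q.1 q.2 p)
      (comap (fun q : ℝ × ℝ => q.1 + |q.2|) atTop ⊓ 𝓟 {q | 0 < q.1}) (cocompact (Pt n)) := by
  rw [← Metric.cobounded_eq_cocompact, ← tendsto_norm_atTop_iff_cobounded, tendsto_atTop]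
  intro M
  rw [eventually_inf_principal]
  have hz : 0 < |p.1 j| := abs_pos.mpr hp
  have := (tendsto_comap (f := fun q : ℝ × ℝ => q.1 + |q.2|) (x := atTop)).eventually
    (eventually_gt_atTop (M / |p.1 j| + (M + (M / |p.1 j|) ^ 2 * |p.2.2|)))
  filter_upwards [this] with q hq hq0
  replace hq0 : 0 < q.1 := hq0
  by_contra! h
  have a1 : q.1 * |p.1 j| < M := by
    have := (norm_le_pi_norm (scalePt n q.1 q.2 p).1 j).trans (norm_fst_le _)
    simp only [scalePt, Real.norm_eq_abs, abs_mul, abs_of_pos hq0] at this h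
    linarith
  have a2 : |q.1 ^ 2 * p.2.2 + q.2| < M := by
    have := (norm_snd_le (scalePt n q.1 q.2 p).2).trans (norm_snd_le _)
    simp only [scalePt, Real.norm_eq_abs] at this h
    linarith
  have a3 : q.1 < M / |p.1 j| := by rwa [lt_div_iff₀ hz]
  have a4 : q.1 ^ 2 * |p.2.2| ≤ (M / |p.1 j|) ^ 2 * |p.2.2| := by gcongr
  have a5 : |q.2| ≤ |q.1 ^ 2 * p.2.2 + q.2| + q.1 ^ 2 * |p.2.2| := by
    have := abs_sub (q.1 ^ 2 * p.2.2 + q.2) (q.1 ^ 2 * p.2.2)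
    rw [abs_mul (q.1 ^ 2), abs_of_nonneg (sq_nonneg q.1)] at this
    simpa using this
  linarith

/-- behavior of `Γ` at infinity: `Γ(μ,s) → b₀ k(∞)` as
`(μ,s) → ∞` in the half-plane. -/
theorem Gamma_limit_at_infinity (n : ℕ) (hn : 1 ≤ n)
    (k : Pt n → ℝ) (kinf : ℝ)
    (hkbd : ∃ C : ℝ, ∀ p : Pt n, |k p| ≤ C)
    (hkcont : Continuous k)
    (hklim : Tendsto k (cocompact (Pt n)) (𝓝 kinf)) :
    ∀ ε : ℝ, 0 < ε → ∃ R : ℝ, 0 < R ∧ ∀ μ s : ℝ, 0 < μ → R < μ + |s| →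
      |Gam n k μ s - ((1 / Qs n) * ∫ p : Pt n, omegaFun n p ^ Qs n) * kinf| < ε := by
  obtain ⟨C, hC⟩ := hkbd
  have hI := Heis_integrable n hn
  have key : Tendsto (fun q : ℝ × ℝ => Gam n k q.1 q.2)
      (comap (fun q : ℝ × ℝ => q.1 + |q.2|) atTop ⊓ 𝓟 {q | 0 < q.1})
      (𝓝 (((1 / Qs n) * ∫ p : Pt n, omegaFun n p ^ Qs n) * kinf)) := by
    unfold Gam
    rw [mul_assoc, ← integral_mul_const]
    refine Tendsto.const_mul _ ?_
    refine tendsto_integral_filter_of_dominated_convergence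
      (fun p => C * ‖omegaFun n p ^ Qs n‖) ?_ ?_ (hI.norm.const_mul C) ?_
    · refine Eventually.of_forall fun q => ?_
      refine AEStronglyMeasurable.mul ?_ hI.aestronglyMeasurable
      refine Continuous.aestronglyMeasurable (hkcont.comp ?_)
      unfold scalePt
      fun_prop
    · refine Eventually.of_forall fun q => ae_of_all _ fun p => ?_
      rw [norm_mul]
      exact mul_le_mul_of_nonneg_right (hC _) (norm_nonneg _)
    · filter_upwards [Heis_ae n ⟨0, hn⟩] with p hp
      rw [mul_comm _ kinf]
      exact (hklim.comp (Heis_scale n _ p hp)).mul_const _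
  intro ε hε
  have h := Metric.tendsto_nhds.mp key ε hε
  rw [eventually_inf_principal, eventually_comap] at h
  obtain ⟨R, hR⟩ := eventually_atTop.mp h
  refine ⟨max R 1, by positivity, fun μ s hμ hs => ?_⟩
  exact hR (μ + |s|) ((le_max_left _ _).trans hs.le) (μ, s) rfl hμ
end
end

section
/- Let k: ℝ^{2n+1} → ℝ be cylindrically symmetric and C¹, with k and its first derivatives bounded. Fix s ∈ ℝ and define g(μ) = (1/Q*) ∫_{ℝ^{2n+1}} k(μz, μ²t+s) ω(z,t)^{Q*} dz dt for μ > 0 and g(0) = k(0,s) · (1/Q*) ∫ ω^{Q*}. Then g is differentiable from the right at μ = 0 with g'(0) = 0, i.e. (g(μ) − g(0))/μ → 0 as μ → 0⁺. -/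
open MeasureTheory Filter Topology

noncomputable section

open Heis
namespace Heis

def Dn (n : ℕ) (p : Pt n) : ℝ := p.2.2 ^ 2 + (1 + (znorm n p) ^ 2) ^ 2

lemma znorm_sq (n : ℕ) (p : Pt n) :
    (znorm n p) ^ 2 = ∑ j, (p.1 j) ^ 2 + ∑ j, (p.2.1 j) ^ 2 :=
  Real.sq_sqrt (by positivity)

lemma sup_sq_le (n : ℕ) (x : Fin n → ℝ) : ‖x‖ ^ 2 ≤ ∑ j, (x j) ^ 2 := by
  have h : ‖x‖ ≤ Real.sqrt (∑ j, (x j) ^ 2) := by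
    rw [pi_norm_le_iff_of_nonneg (Real.sqrt_nonneg _)]
    intro i
    rw [Real.norm_eq_abs]
    apply Real.abs_le_sqrt
    exact Finset.single_le_sum (f := fun j => (x j) ^ 2) (fun j _ => sq_nonneg _) (Finset.mem_univ i)
  calc ‖x‖ ^ 2 ≤ (Real.sqrt (∑ j, (x j) ^ 2)) ^ 2 := by gcongr
    _ = _ := Real.sq_sqrt (by positivity)

lemma x_le_z (n : ℕ) (p : Pt n) : ‖p.1‖ ^ 2 ≤ (znorm n p) ^ 2 := by
  rw [znorm_sq]
  have := sup_sq_le n p.1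
  have : 0 ≤ ∑ j, (p.2.1 j) ^ 2 := by positivity
  linarith

lemma y_le_z (n : ℕ) (p : Pt n) : ‖p.2.1‖ ^ 2 ≤ (znorm n p) ^ 2 := by
  rw [znorm_sq]
  have := sup_sq_le n p.2.1
  have : 0 ≤ ∑ j, (p.1 j) ^ 2 := by positivity
  linarith

lemma Dn_ge_t (n : ℕ) (p : Pt n) : 1 + ‖p.2.2‖ ^ 2 ≤ Dn n p := by
  unfold Dn
  rw [Real.norm_eq_abs, sq_abs]
  nlinarith [sq_nonneg (znorm n p), sq_nonneg (znorm n p ^ 2)]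

lemma Dn_ge_of (n : ℕ) (p : Pt n) (a : ℝ) (h : a ^ 2 ≤ (znorm n p) ^ 2) :
    (1 + a ^ 2) ^ 2 ≤ Dn n p := by
  unfold Dn
  have : (1 + a ^ 2) ^ 2 ≤ (1 + (znorm n p) ^ 2) ^ 2 := by gcongr
  nlinarith [sq_nonneg p.2.2]

lemma Dn_pos (n : ℕ) (p : Pt n) : 0 < Dn n p := by
  have := Dn_ge_t n p
  have : 0 ≤ ‖p.2.2‖ ^ 2 := by positivity
  linarith

lemma Dn_cont (n : ℕ) : Continuous (Dn n) := by
  have : Dn n = fun p : Pt n => p.2.2 ^ 2 + (1 + (∑ j, (p.1 j) ^ 2 + ∑ j, (p.2.1 j) ^ 2)) ^ 2 := by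
    funext p; rw [Dn, znorm_sq]
  rw [this]
  fun_prop

lemma Dn_rpow_cont (n : ℕ) (r : ℝ) : Continuous (fun p => Dn n p ^ r) :=
  (Dn_cont n).rpow_const (fun p => Or.inl (Dn_pos n p).ne')

lemma int_D (n : ℕ) (hn : 1 ≤ n) : Integrable (fun p : Pt n => Dn n p ^ (-((n : ℝ) + 1 / 2))) := by
  have hn' : (1 : ℝ) ≤ n := by exact_mod_cast hn
  have h1 : Integrable (fun x : Fin n → ℝ => (1 + ‖x‖ ^ 2) ^ (-(2 * (n : ℝ) - 1 / 2) / 2)) := by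
    apply integrable_rpow_neg_one_add_norm_sq
    simp; linarith
  have h2 : Integrable (fun x : ℝ => (1 + ‖x‖ ^ 2) ^ (-(3 / 2 : ℝ) / 2)) := by
    apply integrable_rpow_neg_one_add_norm_sq
    simp; norm_num
  have h3 := h1.mul_prod (h1.mul_prod h2)
  refine h3.mono' (Dn_rpow_cont n _).aestronglyMeasurable (ae_of_all _ fun p => ?_)
  have hD := Dn_pos n p
  have key : ∀ a : ℝ, a ^ 2 ≤ (znorm n p) ^ 2 →
      Dn n p ^ (-((n : ℝ) / 2 - 1 / 8)) ≤ (1 + a ^ 2) ^ (-(2 * (n : ℝ) - 1 / 2) / 2) := by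
    intro a ha
    calc Dn n p ^ (-((n : ℝ) / 2 - 1 / 8)) ≤ ((1 + a ^ 2) ^ 2) ^ (-((n : ℝ) / 2 - 1 / 8)) :=
          Real.rpow_le_rpow_of_nonpos (by positivity) (Dn_ge_of n p a ha) (by linarith)
      _ = _ := by
          rw [← Real.rpow_natCast, ← Real.rpow_mul (by positivity)]
          congr 1; push_cast; ring
  have kt : Dn n p ^ (-(3 / 4 : ℝ)) ≤ (1 + ‖p.2.2‖ ^ 2) ^ (-(3 / 2 : ℝ) / 2) := by
    rw [show (-(3 / 2 : ℝ) / 2) = -(3 / 4) by norm_num]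
    exact Real.rpow_le_rpow_of_nonpos (by positivity) (Dn_ge_t n p) (by norm_num)
  rw [Real.norm_of_nonneg (by positivity),
    show (-((n : ℝ) + 1 / 2)) = -((n : ℝ) / 2 - 1 / 8) + (-((n : ℝ) / 2 - 1 / 8) + -(3 / 4)) by ring,
    Real.rpow_add hD, Real.rpow_add hD]
  have := key _ (x_le_z n p)
  have := key _ (y_le_z n p)
  gcongr

lemma om_eq (n : ℕ) (hn : 1 ≤ n) : ∃ c : ℝ, 0 ≤ c ∧
    ∀ p, omegaFun n p ^ Qs n = c * Dn n p ^ (-((n : ℝ) + 1)) := by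
  have hn' : (1 : ℝ) ≤ n := by exact_mod_cast hn
  have hq : Qh n - 2 = 2 * n := by unfold Qh; ring
  refine ⟨((Qh n - 2) ^ ((Qh n - 2) / 2)) ^ Qs n, ?_, fun p => ?_⟩
  · rw [hq]; positivity
  · unfold omegaFun
    have hD := Dn_pos n p
    change (_ * Dn n p ^ _) ^ _ = _
    rw [Real.mul_rpow (by rw [hq]; positivity) (by positivity), ← Real.rpow_mul hD.le]
    congr 2
    unfold Qs
    rw [hq]; unfold Qh; field_simp; ring

lemma scale_diff (n : ℕ) (μ s : ℝ) (h0 : 0 ≤ μ) (h1 : μ ≤ 1) (p : Pt n) :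
    ‖scalePt n μ s p - (0, 0, s)‖ ≤ μ * Dn n p ^ (1 / 2 : ℝ) := by
  have hD := Dn_pos n p
  have key : ∀ a : ℝ, a ^ 2 ≤ (znorm n p) ^ 2 → a ≤ Dn n p ^ (1 / 2 : ℝ) := by
    intro a ha
    rw [← Real.sqrt_eq_rpow]
    apply Real.le_sqrt_of_sq_le
    have := Dn_ge_of n p a ha
    nlinarith [sq_nonneg a, sq_nonneg (a ^ 2)]
  have kt : ‖p.2.2‖ ≤ Dn n p ^ (1 / 2 : ℝ) := by
    rw [← Real.sqrt_eq_rpow]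
    apply Real.le_sqrt_of_sq_le
    have := Dn_ge_t n p
    linarith
  have e : scalePt n μ s p - (0, 0, s) = (μ • p.1, μ • p.2.1, μ ^ 2 * p.2.2) := by
    ext <;> simp [scalePt]
  rw [e, Prod.norm_def, Prod.norm_def]
  simp only [norm_smul, norm_mul, norm_pow, Real.norm_of_nonneg h0]
  refine max_le ?_ (max_le ?_ ?_)
  · gcongr; exact key _ (x_le_z n p)
  · gcongr; exact key _ (y_le_z n p)
  · gcongr
    nlinarith

lemma ptwise (n : ℕ) (k : Pt n → ℝ) (hkcyl : IsCyl n k) (hk : ContDiff ℝ 1 k) (s : ℝ) (p : Pt n) :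
    Tendsto (fun μ : ℝ => (k (scalePt n μ s p) - k (0, 0, s)) / μ) (𝓝[Set.Ioi (0 : ℝ)] 0) (𝓝 0) := by
  have hd : Differentiable ℝ (fun μ : ℝ => k (scalePt n μ s p)) := by
    have : Differentiable ℝ (fun μ : ℝ => scalePt n μ s p) := by unfold scalePt; fun_prop
    exact (hk.differentiable (by norm_num)).comp this
  have he : (fun μ : ℝ => k (scalePt n (-μ) s p)) = fun μ : ℝ => k (scalePt n μ s p) := by
    obtain ⟨v, hv⟩ := hkcyl
    funext μ
    rw [hv, hv]
    simp [scalePt, znorm]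
  have h0 := (hd 0).hasDerivAt
  have hz : deriv (fun μ : ℝ => k (scalePt n μ s p)) 0 = 0 := by
    have := deriv_comp_neg (fun μ : ℝ => k (scalePt n μ s p)) 0
    rw [he] at this
    simp only [neg_zero] at this
    linarith
  rw [hz] at h0
  have := h0.tendsto_slope_zero_right
  refine this.congr fun μ => ?_
  have e : scalePt n 0 s p = (0, 0, s) := by ext <;> simp [scalePt]
  simp only [zero_add, e, smul_eq_mul]
  ring

end Heis

/-- first derivative of the reduced functional at `μ = 0`:
for cylindrically symmetric `C¹` `k` with bounded derivatives, the function
`g(μ) = Γ(μ,s)` is differentiable from the right at `μ = 0` with `g'(0) = 0`. -/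
theorem Gamma_right_derivative_zero (n : ℕ) (hn : 1 ≤ n)
    (k : Pt n → ℝ)
    (hkcyl : IsCyl n k)
    (hk : ContDiff ℝ 1 k)
    (hkbd : ∃ C : ℝ, ∀ p : Pt n, |k p| ≤ C ∧ ‖fderiv ℝ k p‖ ≤ C)
    (s : ℝ) :
    Tendsto (fun μ : ℝ =>
        (Gam n k μ s -
          ((1 / Qs n) * ∫ p : Pt n, omegaFun n p ^ Qs n) * k (0, 0, s)) / μ)
      (𝓝[Set.Ioi (0 : ℝ)] 0) (𝓝 0) := by
  obtain ⟨C, hC⟩ := hkbd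
  obtain ⟨c, hc, hom⟩ := om_eq n hn
  have hC0 : 0 ≤ C := (norm_nonneg _).trans (hC 0).2
  have hD1 : ∀ p : Pt n, 1 ≤ Dn n p := fun p => by
    have := Dn_ge_t n p
    have : 0 ≤ ‖p.2.2‖ ^ 2 := by positivity
    linarith
  have hWc : Continuous (fun p : Pt n => omegaFun n p ^ Qs n) := by
    simp only [hom]
    exact continuous_const.mul (Dn_rpow_cont n _)
  have hWi : Integrable (fun p : Pt n => omegaFun n p ^ Qs n) := by
    refine ((int_D n hn).const_mul c).mono' hWc.aestronglyMeasurable (ae_of_all _ fun p => ?_)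
    have hD := Dn_pos n p
    simp only [hom]
    rw [Real.norm_of_nonneg (by positivity)]
    gcongr
    · exact hD1 p
    · norm_num
  have hsc : ∀ μ : ℝ, Continuous (fun p : Pt n => k (scalePt n μ s p)) := fun μ => by
    have : Continuous (fun p : Pt n => scalePt n μ s p) := by unfold scalePt; fun_prop
    exact hk.continuous.comp this
  have hkWi : ∀ μ : ℝ, Integrable (fun p : Pt n => k (scalePt n μ s p) * omegaFun n p ^ Qs n) :=
    fun μ => hWi.bdd_mul (hsc μ).aestronglyMeasurable (ae_of_all _ fun p => (hC _).1)
  have hlim : Tendsto (fun μ : ℝ => ∫ p : Pt n,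
      (k (scalePt n μ s p) - k (0, 0, s)) / μ * omegaFun n p ^ Qs n)
      (𝓝[Set.Ioi (0 : ℝ)] 0) (𝓝 (∫ _ : Pt n, (0 : ℝ))) := by
    apply tendsto_integral_filter_of_dominated_convergence
      (fun p => C * c * Dn n p ^ (-((n : ℝ) + 1 / 2)))
    · exact Eventually.of_forall fun μ =>
        ((((hsc μ).sub continuous_const).div_const μ).mul hWc).aestronglyMeasurable
    · filter_upwards [Ioo_mem_nhdsGT (zero_lt_one' ℝ)] with μ hμ
      refine ae_of_all _ fun p => ?_
      have hD := Dn_pos n p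
      have hμ0 : 0 < μ := hμ.1
      have hl : ‖k (scalePt n μ s p) - k (0, 0, s)‖ ≤ C * ‖scalePt n μ s p - (0, 0, s)‖ :=
        Convex.norm_image_sub_le_of_norm_fderiv_le (𝕜 := ℝ) (s := Set.univ)
          (fun x _ => (hk.differentiable (by norm_num)) x) (fun x _ => (hC x).2) convex_univ
          (Set.mem_univ _) (Set.mem_univ _)
      have h2 := hl.trans (mul_le_mul_of_nonneg_left (scale_diff n μ s hμ0.le hμ.2.le p) hC0)
      have h3 : ‖k (scalePt n μ s p) - k (0, 0, s)‖ / μ ≤ C * Dn n p ^ (1 / 2 : ℝ) := by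
        rw [div_le_iff₀ hμ0]; linarith
      rw [hom, norm_mul, norm_div, Real.norm_of_nonneg hμ0.le,
        Real.norm_of_nonneg (by positivity : 0 ≤ c * Dn n p ^ (-((n : ℝ) + 1)))]
      calc _ ≤ (C * Dn n p ^ (1 / 2 : ℝ)) * (c * Dn n p ^ (-((n : ℝ) + 1))) := by gcongr
        _ = C * c * (Dn n p ^ (1 / 2 : ℝ) * Dn n p ^ (-((n : ℝ) + 1))) := by ring
        _ = _ := by
          rw [← Real.rpow_add hD]; congr 2; ring
    · exact (int_D n hn).const_mul _
    · refine ae_of_all _ fun p => ?_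
      simpa using (ptwise n k hkcyl hk s p).mul_const (omegaFun n p ^ Qs n)
  have h4 := hlim.const_mul (1 / Qs n)
  simp only [integral_zero, mul_zero] at h4
  refine h4.congr fun μ => ?_
  have : (fun p : Pt n => (k (scalePt n μ s p) - k (0, 0, s)) / μ * omegaFun n p ^ Qs n) =
      fun p => (k (scalePt n μ s p) * omegaFun n p ^ Qs n
        - k (0, 0, s) * omegaFun n p ^ Qs n) / μ := by
    funext p; ring
  rw [this, integral_div, integral_sub (hkWi μ) (hWi.const_mul _), integral_const_mul]
  unfold Gam
  ring
end
end

section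
/- Let k: ℝ^{2n+1} → ℝ be cylindrically symmetric and C², with k and its first and second derivatives bounded. Fix s ∈ ℝ and define g(μ) = (1/Q*) ∫_{ℝ^{2n+1}} k(μz, μ²t+s) ω(z,t)^{Q*} dz dt for μ > 0 and g(0) = k(0,s) · (1/Q*) ∫ ω^{Q*}. Then, as μ → 0⁺, g(μ) = g(0) + (μ²/2) c + o(μ²), where c = (1/(2n Q*)) Δ_{x,y}k(0,s) ∫_{ℝ^{2n+1}} |z|² ω(z,t)^{Q*} dz dt, Δ_{x,y}k = Σ_{i=1}^n (∂²k/∂x_i² + ∂²k/∂y_i²), and the integral ∫ |z|² ω^{Q*} is finite. -/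
open MeasureTheory Filter Topology

noncomputable section

open Heis

lemma aux_znorm_sq (n : ℕ) (p : Pt n) :
    znorm n p ^ 2 = ∑ j, (p.1 j) ^ 2 + ∑ j, (p.2.1 j) ^ 2 := by
  unfold znorm
  rw [Real.sq_sqrt]
  positivity

lemma aux_norm_sq_le (n : ℕ) (x : Fin n → ℝ) : ‖x‖ ^ 2 ≤ ∑ j, (x j) ^ 2 := by
  have h0 : 0 ≤ ∑ j, (x j) ^ 2 := by positivity
  rw [← Real.sq_sqrt h0]
  gcongr
  rw [pi_norm_le_iff_of_nonneg (Real.sqrt_nonneg _)]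
  intro i
  rw [Real.norm_eq_abs]
  apply Real.abs_le_sqrt
  exact Finset.single_le_sum (f := fun j => (x j) ^ 2) (fun j _ => sq_nonneg _) (Finset.mem_univ i)

/-- base of omega -/
def auxD (n : ℕ) (p : Pt n) : ℝ := p.2.2 ^ 2 + (1 + znorm n p ^ 2) ^ 2

lemma auxD_pos (n : ℕ) (p : Pt n) : 0 < auxD n p := by
  unfold auxD; positivity

lemma aux_znorm_cont (n : ℕ) : Continuous (znorm n) := by
  unfold znorm; fun_prop

lemma auxD_cont (n : ℕ) : Continuous (auxD n) := by
  have := aux_znorm_cont n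
  unfold auxD; fun_prop

lemma aux_W (n : ℕ) (hn : 1 ≤ n) (p : Pt n) :
    omegaFun n p ^ Qs n =
      ((Qh n - 2) ^ ((Qh n - 2) / 2)) ^ Qs n * auxD n p ^ (-((n : ℝ) + 1)) := by
  have hn' : (0 : ℝ) < n := by exact_mod_cast hn
  have hq : Qh n - 2 = 2 * n := by unfold Qh; ring
  unfold omegaFun
  rw [Real.mul_rpow (Real.rpow_nonneg (by rw [hq]; positivity) _)
    (Real.rpow_nonneg (by positivity) _)]
  congr 1
  rw [← Real.rpow_mul (by positivity)]
  unfold auxD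
  congr 1
  unfold Qs
  rw [hq]; unfold Qh
  field_simp
  ring

lemma aux_W_nonneg (n : ℕ) (hn : 1 ≤ n) (p : Pt n) : 0 ≤ omegaFun n p ^ Qs n := by
  have hq : Qh n - 2 = 2 * n := by unfold Qh; ring
  rw [aux_W n hn]
  exact mul_nonneg (Real.rpow_nonneg (Real.rpow_nonneg (by rw [hq]; positivity) _) _)
    (Real.rpow_nonneg (auxD_pos n p).le _)

lemma aux_W_cont (n : ℕ) (hn : 1 ≤ n) : Continuous (fun p => omegaFun n p ^ Qs n) := by
  simp_rw [aux_W n hn]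
  exact continuous_const.mul ((auxD_cont n).rpow_const (fun p => Or.inl (auxD_pos n p).ne'))

lemma aux_base_int (n : ℕ) (hn : 1 ≤ n) :
    Integrable (fun p : Pt n => auxD n p ^ (-((n : ℝ) + 1 / 2))) volume := by
  have hn' : (1 : ℝ) ≤ n := by exact_mod_cast hn
  have h1 : Integrable (fun x : Fin n → ℝ => ((1 : ℝ) + ‖x‖ ^ 2) ^ (-(2 * (n : ℝ) - 1 / 2) / 2))
      volume := integrable_rpow_neg_one_add_norm_sq (by simp; linarith)
  have h3 : Integrable (fun x : ℝ => ((1 : ℝ) + ‖x‖ ^ 2) ^ (-(3 / 2 : ℝ) / 2))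
      volume := integrable_rpow_neg_one_add_norm_sq (by simp; norm_num)
  have h := h1.mul_prod (h1.mul_prod h3)
  refine Integrable.mono' h ?_ (Eventually.of_forall fun p => ?_)
  · exact ((auxD_cont n).rpow_const
      (fun p => Or.inl (auxD_pos n p).ne')).aestronglyMeasurable
  · rw [Real.norm_of_nonneg (Real.rpow_nonneg (auxD_pos n p).le _)]
    have e : -((n : ℝ) + 1 / 2) = (-(2 * (n : ℝ) - 1 / 2) / 2) + (-(3 / 2 : ℝ) / 2) := by ring
    have hz := aux_znorm_sq n p
    have hx := aux_norm_sq_le n p.1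
    have hy := aux_norm_sq_le n p.2.1
    rw [e, Real.rpow_add (auxD_pos n p), ← mul_assoc,
      ← Real.mul_rpow (by positivity) (by positivity)]
    have hX := sq_nonneg ‖p.1‖
    have hY := sq_nonneg ‖p.2.1‖
    refine mul_le_mul ?_ ?_ (Real.rpow_nonneg (auxD_pos n p).le _)
      (Real.rpow_nonneg (by positivity) _)
    · apply Real.rpow_le_rpow_of_nonpos (by positivity)
      · unfold auxD
        nlinarith [sq_nonneg p.2.2]
      · linarith
    · apply Real.rpow_le_rpow_of_nonpos (by positivity)
      · unfold auxD
        rw [Real.norm_eq_abs, sq_abs]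
        nlinarith [sq_nonneg (znorm n p)]
      · norm_num

lemma aux_dom_int (n : ℕ) (hn : 1 ≤ n) :
    Integrable (fun p : Pt n => (1 + znorm n p ^ 2 + |p.2.2|) * omegaFun n p ^ Qs n) volume := by
  have hq : Qh n - 2 = 2 * n := by unfold Qh; ring
  have hc := aux_W_cont n hn
  have hz := aux_znorm_cont n
  refine Integrable.mono' ((aux_base_int n hn).const_mul
    (2 * ((Qh n - 2) ^ ((Qh n - 2) / 2)) ^ Qs n)) ?_ (Eventually.of_forall fun p => ?_)
  · apply Continuous.aestronglyMeasurable
    fun_prop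
  · rw [Real.norm_of_nonneg (mul_nonneg (by positivity) (aux_W_nonneg n hn p)), aux_W n hn]
    have hC : 0 ≤ ((Qh n - 2) ^ ((Qh n - 2) / 2)) ^ Qs n :=
      Real.rpow_nonneg (Real.rpow_nonneg (by rw [hq]; positivity) _) _
    set c := ((Qh n - 2) ^ ((Qh n - 2) / 2)) ^ Qs n
    have e : -((n : ℝ) + 1 / 2) = 1 / 2 + -((n : ℝ) + 1) := by ring
    rw [e, Real.rpow_add (auxD_pos n p), ← Real.sqrt_eq_rpow]
    have key : 1 + znorm n p ^ 2 + |p.2.2| ≤ 2 * √(auxD n p) := by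
      have h1 : 1 + znorm n p ^ 2 ≤ √(auxD n p) := by
        apply Real.le_sqrt_of_sq_le; unfold auxD; nlinarith [sq_nonneg p.2.2]
      have h2 : |p.2.2| ≤ √(auxD n p) := by
        apply Real.abs_le_sqrt; unfold auxD; nlinarith [sq_nonneg (1 + znorm n p ^ 2)]
      linarith
    have hD := Real.rpow_nonneg (auxD_pos n p).le (-((n : ℝ) + 1))
    calc _ ≤ 2 * √(auxD n p) * (c * auxD n p ^ (-((n : ℝ) + 1))) := by gcongr
      _ = _ := by ring

lemma aux_int_of_le (n : ℕ) (hn : 1 ≤ n) (f : Pt n → ℝ) (hf : Continuous f) (C : ℝ)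
    (h : ∀ p, |f p| ≤ C * (1 + znorm n p ^ 2 + |p.2.2|)) :
    Integrable (fun p : Pt n => f p * omegaFun n p ^ Qs n) volume := by
  refine Integrable.mono' ((aux_dom_int n hn).const_mul C)
    (hf.mul (aux_W_cont n hn)).aestronglyMeasurable (Eventually.of_forall fun p => ?_)
  rw [norm_mul, Real.norm_eq_abs, Real.norm_of_nonneg (aux_W_nonneg n hn p), ← mul_assoc]
  exact mul_le_mul_of_nonneg_right (h p) (aux_W_nonneg n hn p)

lemma aux_odd (n : ℕ) : ∫ p : Pt n, p.2.2 * omegaFun n p ^ Qs n = 0 := by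
  let e : Pt n ≃ₜ Pt n := (Homeomorph.refl _).prodCongr
    ((Homeomorph.refl _).prodCongr (Homeomorph.neg ℝ))
  have hmp : MeasurePreserving e volume volume :=
    (MeasurePreserving.id volume).prod
      ((MeasurePreserving.id volume).prod (Measure.measurePreserving_neg volume))
  have h := hmp.integral_comp e.measurableEmbedding (fun p : Pt n => p.2.2 * omegaFun n p ^ Qs n)
  have h2 : ∀ p : Pt n, (e p).2.2 * omegaFun n (e p) ^ Qs n = -(p.2.2 * omegaFun n p ^ Qs n) := by
    intro p
    have : e p = (p.1, p.2.1, -p.2.2) := rfl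
    rw [this]
    simp [omegaFun, znorm]
  simp_rw [h2, integral_neg] at h
  linarith

lemma aux_taylor (φ : ℝ → ℝ) (h : ContDiff ℝ 2 φ) (hev : ∀ r, φ (-r) = φ r) (r : ℝ) (hr : 0 < r) :
    ∃ ξ ∈ Set.Ioo 0 r, φ r - φ 0 = deriv (deriv φ) ξ * r ^ 2 / 2 := by
  have hd : Differentiable ℝ φ := h.differentiable (by norm_num)
  have h0 : deriv φ 0 = 0 := by
    have h1 : HasDerivAt φ (deriv φ 0) (-0) := by simpa using (hd 0).hasDerivAt
    have h2 : HasDerivAt (fun r => φ (-r)) (deriv φ 0 * (-1)) 0 :=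
      h1.comp 0 (hasDerivAt_neg 0)
    have h3 : (fun r => φ (-r)) = φ := funext hev
    rw [h3] at h2
    have := h2.deriv
    linarith
  obtain ⟨ξ, hξ, he⟩ := taylor_mean_remainder_lagrange_iteratedDeriv (n := 1) (x₀ := 0) (x := r)
    hr.ne (h.contDiffOn (s := Set.uIcc 0 r))
  refine ⟨ξ, ?_, ?_⟩
  · simpa [Set.uIoo, hr.le] using hξ
  · have hw : derivWithin φ (Set.uIcc 0 r) 0 = 0 := by
      rw [(hd 0).derivWithin]
      · exact h0
      · exact (uniqueDiffOn_uIcc hr.ne) 0 (by simp)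
    simp [taylorWithinEval_succ, iteratedDerivWithin_one, iteratedDeriv_succ, hw,
      iteratedDeriv_zero, Nat.factorial] at he
    linarith

lemma aux_line (n : ℕ) (k : Pt n → ℝ) (hk : ContDiff ℝ 2 k) (a e : Pt n) :
    deriv (deriv (fun r : ℝ => k (a + r • e))) =
      fun r => fderiv ℝ (fun q => fderiv ℝ k q e) (a + r • e) e := by
  have hl : ∀ r : ℝ, HasDerivAt (fun r : ℝ => a + r • e) e r := by
    intro r
    simpa using ((hasDerivAt_id r).smul_const e).const_add a
  have hk1 : Differentiable ℝ k := hk.differentiable (by norm_num)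
  have hk2 : Differentiable ℝ (fun q => fderiv ℝ k q e) := by
    have : ContDiff ℝ 1 (fderiv ℝ k) := hk.fderiv_right (by norm_num)
    exact (this.differentiable (by norm_num)).clm_apply (differentiable_const _)
  have h1 : deriv (fun r : ℝ => k (a + r • e)) = fun r => fderiv ℝ k (a + r • e) e := by
    funext r
    exact ((hk1 _).hasFDerivAt.comp_hasDerivAt r (hl r)).deriv
  rw [h1]
  funext r
  exact (((hk2 (a + r • e)).hasFDerivAt).comp_hasDerivAt r (hl r)).deriv

lemma aux_second_bd (n : ℕ) (k : Pt n → ℝ) (hk : ContDiff ℝ 2 k) (C : ℝ)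
    (hC : ∀ p : Pt n, ‖iteratedFDeriv ℝ 2 k p‖ ≤ C) (p e : Pt n) (he : ‖e‖ ≤ 1) :
    |fderiv ℝ (fun q => fderiv ℝ k q e) p e| ≤ C := by
  have hd : Differentiable ℝ (fderiv ℝ k) :=
    (hk.fderiv_right (m := 1) (by norm_num)).differentiable (by norm_num)
  have h1 : fderiv ℝ (fun q => fderiv ℝ k q e) p e = iteratedFDeriv ℝ 2 k p ![e, e] := by
    rw [iteratedFDeriv_two_apply, fderiv_clm_apply (hd p) (by fun_prop)]
    simp
  rw [h1, ← Real.norm_eq_abs]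
  refine (ContinuousMultilinearMap.le_opNorm _ _).trans ?_
  have h0 : 0 ≤ C := (norm_nonneg _).trans (hC p)
  simp only [Fin.prod_univ_two, Matrix.cons_val_zero, Matrix.cons_val_one]
  calc _ ≤ C * (1 * 1) := by gcongr; exact hC p
    _ = C := by ring

lemma aux_main (n : ℕ) (hn : 1 ≤ n) (k : Pt n → ℝ) (hkcyl : IsCyl n k) (hk : ContDiff ℝ 2 k)
    (C : ℝ) (hC : ∀ p : Pt n, ∀ i : ℕ, i ≤ 2 → ‖iteratedFDeriv ℝ i k p‖ ≤ C) (s : ℝ) :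
    (∀ μ : ℝ, 0 < μ → ∀ p : Pt n,
      |(k (scalePt n μ s p) - k (0, 0, s)) / μ ^ 2| ≤ C * (1 + znorm n p ^ 2 + |p.2.2|)) ∧
    ∃ T : ℝ, ∀ p : Pt n,
      Tendsto (fun μ : ℝ => (k (scalePt n μ s p) - k (0, 0, s)) / μ ^ 2) (𝓝[Set.Ioi (0 : ℝ)] 0)
        (𝓝 (p.2.2 * T + lapXY n k (0, 0, s) / (2 * n) * (znorm n p ^ 2 / 2))) := by
  have hn' : (0 : ℝ) < n := by exact_mod_cast hn
  obtain ⟨v, hv⟩ := hkcyl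
  have hC0 : 0 ≤ C := (norm_nonneg _).trans (hC 0 0 (by norm_num))
  set a : Pt n := (0, 0, s) with ha
  have hx : ∀ (j : Fin n) (r : ℝ), k (a + r • ex n j) = v |r| s := by
    intro j r
    rw [hv]
    congr 1
    · unfold znorm
      rw [← Real.sqrt_sq_eq_abs]
      simp [ha, ex, Pi.single_apply, ite_pow]
    · simp [ha, ex]
  have hy : ∀ (j : Fin n) (r : ℝ), k (a + r • ey n j) = v |r| s := by
    intro j r
    rw [hv]
    congr 1
    · unfold znorm
      rw [← Real.sqrt_sq_eq_abs]
      simp [ha, ey, Pi.single_apply, ite_pow]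
    · simp [ha, ey]
  set φ : ℝ → ℝ := fun r => v |r| s with hφ
  have j0 : Fin n := ⟨0, hn⟩
  have hφx : ∀ j, (fun r : ℝ => k (a + r • ex n j)) = φ := fun j => funext (hx j)
  have hφy : ∀ j, (fun r : ℝ => k (a + r • ey n j)) = φ := fun j => funext (hy j)
  have hφC : ContDiff ℝ 2 φ := by
    rw [← hφx j0]
    exact hk.comp (contDiff_const.add (contDiff_id.smul contDiff_const))
  have hφev : ∀ r, φ (-r) = φ r := by intro r; simp [hφ]
  have hdd : Continuous (deriv (deriv φ)) := by
    have := hφC.continuous_iteratedDeriv 2 le_rfl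
    simpa [iteratedDeriv_succ, iteratedDeriv_zero] using this
  have hbd : ∀ r, |deriv (deriv φ) r| ≤ C := by
    intro r
    rw [← hφx j0, aux_line n k hk]
    apply aux_second_bd n k hk C (fun p => hC p 2 le_rfl)
    have h1 : ‖(Pi.single j0 1 : Fin n → ℝ)‖ ≤ 1 := by
      rw [pi_norm_le_iff_of_nonneg zero_le_one]
      intro i
      rw [Pi.single_apply]
      split_ifs <;> simp
    simpa [ex, Prod.norm_def] using h1
  have hlap : lapXY n k a = 2 * n * deriv (deriv φ) 0 := by
    have e1 : ∀ j, fderiv ℝ (fun q => fderiv ℝ k q (ex n j)) a (ex n j) = deriv (deriv φ) 0 := by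
      intro j
      rw [← hφx j, aux_line n k hk]; simp
    have e2 : ∀ j, fderiv ℝ (fun q => fderiv ℝ k q (ey n j)) a (ey n j) = deriv (deriv φ) 0 := by
      intro j
      rw [← hφy j, aux_line n k hk]; simp
    unfold lapXY
    simp_rw [e1, e2]
    simp; ring
  set lam := deriv (deriv φ) 0 with hlam
  have hlap' : lapXY n k a / (2 * n) = lam := by rw [hlap]; field_simp
  rw [hlap']
  let b : ℝ → Pt n → Pt n := fun μ p => (fun j => μ * p.1 j, fun j => μ * p.2.1 j, s)
  have hkb : ∀ μ : ℝ, 0 < μ → ∀ p, k (b μ p) = φ (μ * znorm n p) := by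
    intro μ hμ p
    rw [hv, hφ]
    have : znorm n (b μ p) = |μ * znorm n p| := by
      rw [← Real.sqrt_sq_eq_abs, mul_pow, aux_znorm_sq]
      unfold znorm
      simp only [b, mul_pow, ← Finset.mul_sum, mul_add]
    rw [this]
  have hka : k a = φ 0 := by rw [← hφx j0]; simp
  have hznn : ∀ p, 0 ≤ znorm n p := fun p => Real.sqrt_nonneg _
  -- Taylor at scale `μ`
  have htay : ∀ μ : ℝ, 0 < μ → ∀ p, ∃ ξ ∈ Set.Icc 0 (μ * znorm n p),
      (k (b μ p) - k a) / μ ^ 2 = deriv (deriv φ) ξ * (znorm n p ^ 2 / 2) := by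
    intro μ hμ p
    rw [hkb μ hμ, hka]
    rcases (hznn p).eq_or_lt with h | h
    · refine ⟨0, by simp [← h], by simp [← h]⟩
    · obtain ⟨ξ, h1, h2⟩ := aux_taylor φ hφC hφev (μ * znorm n p) (by positivity)
      refine ⟨ξ, ⟨h1.1.le, h1.2.le⟩, ?_⟩
      rw [h2]; field_simp
  have hsub : ∀ μ p, scalePt n μ s p - b μ p = (μ ^ 2 * p.2.2) • et n := by
    intro μ p
    simp only [scalePt, b, et]
    ext <;> simp
  have hetn : ‖et n‖ = 1 := by simp [et, Prod.norm_def]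
  have hsplit : ∀ μ p, (k (scalePt n μ s p) - k a) / μ ^ 2 =
      (k (scalePt n μ s p) - k (b μ p)) / μ ^ 2 + (k (b μ p) - k a) / μ ^ 2 := by
    intro μ p; ring
  constructor
  · intro μ hμ p
    rw [hsplit]
    obtain ⟨ξ, h1, h2⟩ := htay μ hμ p
    rw [h2]
    have hA : |(k (scalePt n μ s p) - k (b μ p)) / μ ^ 2| ≤ C * |p.2.2| := by
      have := (convex_univ (𝕜 := ℝ) (E := Pt n)).norm_image_sub_le_of_norm_fderiv_le (f := k) (C := C)
        (fun x _ => (hk.differentiable (by norm_num)) x)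
        (fun x _ => by rw [← norm_iteratedFDeriv_one]; exact hC x 1 (by norm_num))
        (Set.mem_univ (b μ p)) (Set.mem_univ (scalePt n μ s p))
      rw [hsub, norm_smul, hetn, Real.norm_eq_abs, Real.norm_eq_abs, abs_mul,
        abs_of_pos (by positivity : 0 < μ ^ 2)] at this
      rw [abs_div, abs_of_pos (by positivity : 0 < μ ^ 2), div_le_iff₀ (by positivity)]
      linarith
    have hB : |deriv (deriv φ) ξ * (znorm n p ^ 2 / 2)| ≤ C * (znorm n p ^ 2 / 2) := by
      rw [abs_mul, abs_of_nonneg (by positivity : 0 ≤ znorm n p ^ 2 / 2)]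
      gcongr
      exact hbd ξ
    refine (abs_add_le _ _).trans ?_
    have := mul_nonneg hC0 (sq_nonneg (znorm n p))
    linarith
  · refine ⟨fderiv ℝ k a (et n), fun p => ?_⟩
    simp_rw [hsplit]
    apply Tendsto.add
    · have hst : HasStrictFDerivAt k (fderiv ℝ k a) a :=
        hk.contDiffAt.hasStrictFDerivAt (by norm_num)
      have ho := hst.isLittleO
      have hcs : Continuous (fun μ : ℝ => (scalePt n μ s p, b μ p)) := by
        simp only [scalePt, b]; fun_prop
      have ht : Tendsto (fun μ : ℝ => (scalePt n μ s p, b μ p)) (𝓝[Set.Ioi (0 : ℝ)] 0)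
          (𝓝 (a, a)) := by
        have h := (hcs.tendsto 0).mono_left (nhdsWithin_le_nhds (s := Set.Ioi (0 : ℝ)))
        have e1 : scalePt n 0 s p = a := by simp [scalePt, ha]; constructor <;> rfl
        have e2 : b 0 p = a := by simp [b, ha]; constructor <;> rfl
        simpa [e1, e2] using h
      have ho2 := ho.comp_tendsto ht
      have ho3 : (fun μ : ℝ => k (scalePt n μ s p) - k (b μ p) - μ ^ 2 * (p.2.2 * fderiv ℝ k a (et n)))
          =o[𝓝[Set.Ioi (0 : ℝ)] 0] (fun μ : ℝ => μ ^ 2) := by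
        refine (ho2.trans_isBigO (Asymptotics.IsBigO.of_bound |p.2.2| (Eventually.of_forall
          fun μ => ?_))).congr_left ?_
        · simp only [Function.comp, hsub, norm_smul, hetn, Real.norm_eq_abs, abs_mul]
          linarith
        · intro μ
          simp only [Function.comp, hsub, map_smul, smul_eq_mul]
          ring
      have h4 := ho3.tendsto_div_nhds_zero
      have h5 := h4.add_const (p.2.2 * fderiv ℝ k a (et n))
      rw [zero_add] at h5
      refine h5.congr' ?_
      filter_upwards [self_mem_nhdsWithin] with μ hμ
      have : μ ≠ 0 := ne_of_gt hμ
      field_simp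
      ring
    · rw [Metric.tendsto_nhdsWithin_nhds]
      have hsc : Tendsto (fun ξ => deriv (deriv φ) ξ * (znorm n p ^ 2 / 2)) (𝓝 0)
          (𝓝 (lam * (znorm n p ^ 2 / 2))) := (hdd.tendsto 0).mul_const _
      rw [Metric.tendsto_nhds_nhds] at hsc
      intro ε hε
      obtain ⟨δ, hδ, h⟩ := hsc ε hε
      refine ⟨δ / (znorm n p + 1), by have := hznn p; positivity, ?_⟩
      intro μ hμ hd
      have hμ' : 0 < μ := hμ
      obtain ⟨ξ, h1, h2⟩ := htay μ hμ p
      rw [h2]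
      apply h
      have hz := hznn p
      rw [Real.dist_eq, sub_zero, abs_of_pos hμ', lt_div_iff₀ (by positivity)] at hd
      rw [Real.dist_eq, sub_zero, abs_of_nonneg h1.1]
      have := h1.2
      nlinarith

/-- second-order expansion of the reduced functional at `μ = 0`:
for cylindrically symmetric `C²` `k` with bounded derivatives of order `≤ 2`,
`g(μ) = g(0) + (μ²/2) c + o(μ²)` as `μ → 0⁺`, with
`c = (1/(2nQ*)) Δ_{x,y}k(0,s) ∫ |z|² ω^{Q*}`. -/
theorem Gamma_second_order_expansion (n : ℕ) (hn : 1 ≤ n)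
    (k : Pt n → ℝ)
    (hkcyl : IsCyl n k)
    (hk : ContDiff ℝ 2 k)
    (hkbd : ∃ C : ℝ, ∀ p : Pt n, ∀ i : ℕ, i ≤ 2 → ‖iteratedFDeriv ℝ i k p‖ ≤ C)
    (s : ℝ) :
    Integrable (fun p : Pt n => (znorm n p) ^ 2 * omegaFun n p ^ Qs n) volume ∧
    Tendsto (fun μ : ℝ =>
        (Gam n k μ s -
            ((1 / Qs n) * ∫ p : Pt n, omegaFun n p ^ Qs n) * k (0, 0, s) -
            μ ^ 2 / 2 * ((1 / (2 * n * Qs n)) * lapXY n k (0, 0, s) *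
              ∫ p : Pt n, (znorm n p) ^ 2 * omegaFun n p ^ Qs n)) / μ ^ 2)
      (𝓝[Set.Ioi (0 : ℝ)] 0) (𝓝 0) := by
  obtain ⟨C, hC⟩ := hkbd
  obtain ⟨hb, T, hT⟩ := aux_main n hn k hkcyl hk C hC s
  have hn' : (0 : ℝ) < n := by exact_mod_cast hn
  have hC0 : 0 ≤ C := (norm_nonneg _).trans (hC 0 0 (by norm_num))
  have hzc := aux_znorm_cont n
  have hz2 : Integrable (fun p : Pt n => (znorm n p) ^ 2 * omegaFun n p ^ Qs n) volume := by
    refine aux_int_of_le n hn _ (by fun_prop) 1 (fun p => ?_)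
    rw [abs_of_nonneg (sq_nonneg _)]
    linarith [abs_nonneg p.2.2]
  have ht1 : Integrable (fun p : Pt n => p.2.2 * omegaFun n p ^ Qs n) volume := by
    refine aux_int_of_le n hn _ (by fun_prop) 1 (fun p => ?_)
    linarith [sq_nonneg (znorm n p)]
  have hW : Integrable (fun p : Pt n => k (0, 0, s) * omegaFun n p ^ Qs n) volume := by
    refine aux_int_of_le n hn _ (by fun_prop) |k (0, 0, s)| (fun p => ?_)
    nlinarith [sq_nonneg (znorm n p), abs_nonneg p.2.2, abs_nonneg (k (0, 0, s)),
      mul_nonneg (abs_nonneg (k (0, 0, s))) (sq_nonneg (znorm n p)),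
      mul_nonneg (abs_nonneg (k (0, 0, s))) (abs_nonneg p.2.2)]
  have hsc : ∀ μ, Continuous (fun p : Pt n => k (scalePt n μ s p)) := by
    intro μ
    refine hk.continuous.comp ?_
    unfold scalePt; fun_prop
  have hkW : ∀ μ, Integrable (fun p : Pt n => k (scalePt n μ s p) * omegaFun n p ^ Qs n) volume := by
    intro μ
    refine aux_int_of_le n hn _ (hsc μ) C (fun p => ?_)
    have h1 := hC (scalePt n μ s p) 0 (by norm_num)
    rw [norm_iteratedFDeriv_zero, Real.norm_eq_abs] at h1
    nlinarith [mul_nonneg hC0 (sq_nonneg (znorm n p)), mul_nonneg hC0 (abs_nonneg p.2.2)]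
  refine ⟨hz2, ?_⟩
  set L := lapXY n k (0, 0, s) with hL
  have hlim : Tendsto (fun μ : ℝ => ∫ p : Pt n,
      (k (scalePt n μ s p) - k (0, 0, s)) / μ ^ 2 * omegaFun n p ^ Qs n) (𝓝[Set.Ioi (0 : ℝ)] 0)
      (𝓝 (∫ p : Pt n, (p.2.2 * T + L / (2 * n) * (znorm n p ^ 2 / 2)) * omegaFun n p ^ Qs n)) := by
    refine tendsto_integral_filter_of_dominated_convergence
      (fun p => C * ((1 + znorm n p ^ 2 + |p.2.2|) * omegaFun n p ^ Qs n)) ?_ ?_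
      ((aux_dom_int n hn).const_mul C) ?_
    · refine Eventually.of_forall fun μ => ?_
      exact ((((hsc μ).sub continuous_const).div_const _).mul
        (aux_W_cont n hn)).aestronglyMeasurable
    · filter_upwards [self_mem_nhdsWithin] with μ hμ
      refine Eventually.of_forall fun p => ?_
      rw [norm_mul, Real.norm_eq_abs, Real.norm_of_nonneg (aux_W_nonneg n hn p), ← mul_assoc]
      exact mul_le_mul_of_nonneg_right (hb μ hμ p) (aux_W_nonneg n hn p)
    · exact Eventually.of_forall fun p => (hT p).mul_const _
  have hval : ∫ p : Pt n, (p.2.2 * T + L / (2 * n) * (znorm n p ^ 2 / 2)) * omegaFun n p ^ Qs n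
      = L / (4 * n) * ∫ p : Pt n, znorm n p ^ 2 * omegaFun n p ^ Qs n := by
    have e : ∀ p : Pt n, (p.2.2 * T + L / (2 * n) * (znorm n p ^ 2 / 2)) * omegaFun n p ^ Qs n
        = T * (p.2.2 * omegaFun n p ^ Qs n)
          + L / (4 * n) * (znorm n p ^ 2 * omegaFun n p ^ Qs n) := by
      intro p; field_simp; ring
    simp_rw [e]
    rw [integral_add (ht1.const_mul _) (hz2.const_mul _), integral_const_mul, integral_const_mul,
      aux_odd]
    ring
  rw [hval] at hlim
  have h2 := (hlim.const_mul (1 / Qs n)).sub_const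
    (1 / Qs n * (L / (4 * n) * ∫ p : Pt n, znorm n p ^ 2 * omegaFun n p ^ Qs n))
  rw [sub_self] at h2
  refine h2.congr' ?_
  filter_upwards [self_mem_nhdsWithin] with μ hμ
  have hμ' : μ ≠ 0 := ne_of_gt hμ
  have e : ∀ p : Pt n, (k (scalePt n μ s p) - k (0, 0, s)) / μ ^ 2 * omegaFun n p ^ Qs n
      = (1 / μ ^ 2) * (k (scalePt n μ s p) * omegaFun n p ^ Qs n
        - k (0, 0, s) * omegaFun n p ^ Qs n) := by
    intro p; ring
  simp_rw [e]
  rw [integral_const_mul, integral_sub (hkW μ) hW, integral_const_mul]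
  unfold Gam
  have hQ : Qs n ≠ 0 := by
    have hq : Qh n - 2 = 2 * n := by unfold Qh; ring
    unfold Qs; rw [hq]; unfold Qh; positivity
  field_simp
  ring
end
end
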